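/- Let p be an odd prime, q = p^r with q ≡ 3 (mod 4), and s = v₂(q+1)+1. Let k be a field of characteristic ≠ 2, let ε be a primitive 2^s-th root of unity and ξ a primitive 2^{s−1}-th root of unity in a fixed algebraic closure of k. Let P be any Sylow 2-subgroup of PGL_n(F_q). Then the minimal faithful representation dimension of P over k equals: for n odd, the minimal faithful representation dimension over k of a Sylow 2-subgroup of GL_{n−1}(F_q); for n = 2, [k(ξ):k] if there exists a k-algebra automorphism of k(ξ) sending ξ to ξ⁻¹, and 2·[k(ξ):k] otherwise; for n = 2m with m ≥ 2 not a power of 2, 2^{1+v₂(m)}·(m−2^{v₂(m)})·[k(ε):k] if there exists a k-algebra automorphism of k(ε) sending ε to ε^{2^{s−1}−1}, and 2^{2+v₂(m)}·(m−2^{v₂(m)})·[k(ε):k] otherwise; and for n = 2m with m = 2^t (t ≥ 1), 2^{2t−1}·[k(ε):k] if such an automorphism ε ↦ ε^{2^{s−1}−1} exists, and 2^{2t}·[k(ε):k] otherwise. -/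

import Mathlib

open IntermediateField

/-- The minimal faithful representation dimension of a group `G` over a field `k`:
the least `d` such that there is an injective group homomorphism `G →* GL d k`. -/
noncomputable def minFaithfulDim (k : Type*) [Field k] (G : Type*) [Group G] : ℕ :=
  sInf {d : ℕ | ∃ φ : G →* Matrix.GeneralLinearGroup (Fin d) k, Function.Injective φ}

/-- The homomorphism from the cyclic group of order `n` sending the generator to `g`. -/
def cyclicLift {G : Type*} [Group G] (n : ℕ) (g : G) (h : g ^ n = 1) :
    Multiplicative (ZMod n) →* G :=
  AddMonoidHom.toMultiplicativeLeft (ZMod.lift n ⟨zmultiplesHom (Additive G) (Additive.ofMul g), by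
    simpa using congrArg Additive.ofMul h⟩)

theorem cyclicLift_ofAdd_intCast {G : Type*} [Group G] (n : ℕ) (g : G) (h : g ^ n = 1) (i : ℤ) :
    cyclicLift n g h (Multiplicative.ofAdd (i : ZMod n)) = g ^ i := by
  simp [cyclicLift]

theorem cyclicLift_ofAdd_natCast {G : Type*} [Group G] (n : ℕ) (g : G) (h : g ^ n = 1) (i : ℕ) :
    cyclicLift n g h (Multiplicative.ofAdd (i : ZMod n)) = g ^ i := by
  simpa using cyclicLift_ofAdd_intCast n g h i

theorem exists_natCast_ofAdd (n : ℕ) [NeZero n] (a : Multiplicative (ZMod n)) :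
    ∃ i < n, a = Multiplicative.ofAdd ((i : ℕ) : ZMod n) :=
  ⟨(Multiplicative.toAdd a).val, ZMod.val_lt _, by simp⟩

/-- The exponent of the twist in the semidihedral group of order `2 ^ (s + 1)`. -/
def twistExp (s : ℕ) : ℕ := 2 ^ (s - 1) - 1

theorem twistExp_add_one (s : ℕ) : twistExp s + 1 = 2 ^ (s - 1) :=
  Nat.sub_add_cancel Nat.one_le_two_pow

theorem two_pow_eq (s : ℕ) (hs : 3 ≤ s) : 2 ^ s = 2 * 2 ^ (s - 1) := by
  obtain ⟨t, rfl⟩ : ∃ t, s = t + 1 := ⟨s - 1, by omega⟩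
  simp [pow_succ, mul_comm]

theorem twistExp_sq (s : ℕ) (hs : 3 ≤ s) :
    ∃ j, twistExp s * twistExp s = 2 ^ s * j + 1 := by
  obtain ⟨t, rfl⟩ : ∃ t, s = t + 3 := ⟨s - 3, by omega⟩
  have h := twistExp_add_one (t + 3)
  have e : 2 ^ (t + 3 - 1) = 4 * 2 ^ t := by
    rw [show t + 3 - 1 = t + 2 by omega, pow_add]; ring
  have h1 : 1 ≤ 2 ^ t := Nat.one_le_two_pow
  obtain ⟨u, hu⟩ := Nat.exists_eq_add_of_le' h1
  refine ⟨2 * 2 ^ t - 1, ?_⟩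
  rw [e] at h
  have h2 : twistExp (t + 3) = 4 * u + 3 := by omega
  have h3 : 2 * 2 ^ t - 1 = 2 * u + 1 := by omega
  rw [h2, h3, pow_add, hu]; ring

theorem pow_twistExp_twistExp {M : Type*} [Monoid M] {s : ℕ} (hs : 3 ≤ s) {a : M}
    (ha : a ^ 2 ^ s = 1) : (a ^ twistExp s) ^ twistExp s = a := by
  obtain ⟨j, hj⟩ := twistExp_sq s hs
  rw [← pow_mul, hj, pow_succ, pow_mul, ha, one_pow, one_mul]

theorem ofAdd_pow_card (n : ℕ) (a : Multiplicative (ZMod n)) : a ^ n = 1 := by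
  apply Multiplicative.toAdd.injective
  simp

/-- The automorphism `a ↦ a ^ (2 ^ (s - 1) - 1)` of the cyclic group of order `2 ^ s`. -/
def twistAut (s : ℕ) (hs : 3 ≤ s) : MulAut (Multiplicative (ZMod (2 ^ s))) where
  toFun a := a ^ twistExp s
  invFun a := a ^ twistExp s
  left_inv a := pow_twistExp_twistExp hs (ofAdd_pow_card _ a)
  right_inv a := pow_twistExp_twistExp hs (ofAdd_pow_card _ a)
  map_mul' a b := mul_pow a b _

theorem twistAut_sq (s : ℕ) (hs : 3 ≤ s) : twistAut s hs ^ 2 = 1 := by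
  ext a
  simp only [sq, MulAut.mul_apply, MulAut.one_apply]
  rw [show (twistAut s hs) ((twistAut s hs) a) = a from
    pow_twistExp_twistExp hs (ofAdd_pow_card _ a)]

/-- The semidihedral group of order `2 ^ (s + 1)`. -/
abbrev Semidihedral (s : ℕ) (hs : 3 ≤ s) : Type :=
  Multiplicative (ZMod (2 ^ s)) ⋊[cyclicLift 2 (twistAut s hs) (twistAut_sq s hs)]
    Multiplicative (ZMod 2)

namespace Semidihedral

variable {s : ℕ} {hs : 3 ≤ s}

/-- The generator of the cyclic subgroup of index two. -/
def rot (s : ℕ) (hs : 3 ≤ s) : Semidihedral s hs :=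
  SemidirectProduct.inl (Multiplicative.ofAdd 1)

/-- The standard noncentral involution. -/
def flip (s : ℕ) (hs : 3 ≤ s) : Semidihedral s hs :=
  SemidirectProduct.inr (Multiplicative.ofAdd 1)

theorem rot_pow (i : ℕ) : rot s hs ^ i =
    SemidirectProduct.inl (Multiplicative.ofAdd ((i : ℕ) : ZMod (2 ^ s))) := by
  rw [rot, ← map_pow, ← ofAdd_nsmul]; simp

theorem rot_pow_two_pow : rot s hs ^ 2 ^ s = 1 := by
  rw [rot_pow, ZMod.natCast_self]; simp

theorem flip_sq : flip s hs * flip s hs = 1 := by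
  rw [flip, ← map_mul, ← ofAdd_add]
  rw [show (1 + 1 : ZMod 2) = 0 from rfl]; simp

theorem flip_inv : (flip s hs)⁻¹ = flip s hs := inv_eq_of_mul_eq_one_left flip_sq

theorem flip_rot_flip : (flip s hs)⁻¹ * rot s hs * flip s hs = rot s hs ^ twistExp s := by
  have h : cyclicLift 2 (twistAut s hs) (twistAut_sq s hs) (Multiplicative.ofAdd 1)
      = twistAut s hs := by
    simpa using cyclicLift_ofAdd_natCast 2 (twistAut s hs) (twistAut_sq s hs) 1
  have := SemidirectProduct.inl_aut (φ := cyclicLift 2 (twistAut s hs) (twistAut_sq s hs))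
    (Multiplicative.ofAdd 1) (Multiplicative.ofAdd 1)
  rw [h] at this
  rw [flip_inv, rot, ← map_pow]
  nth_rewrite 2 [← flip_inv]
  rw [flip, ← map_inv]
  exact this.symm

theorem exists_eq (g : Semidihedral s hs) :
    ∃ i < 2 ^ s, g = rot s hs ^ i ∨ g = rot s hs ^ i * flip s hs := by
  obtain ⟨i, hi, h⟩ := exists_natCast_ofAdd (2 ^ s) g.left
  obtain ⟨j, hj, h'⟩ := exists_natCast_ofAdd 2 g.right
  refine ⟨i, hi, ?_⟩
  rw [rot_pow, ← h, ← SemidirectProduct.inl_left_mul_inr_right g, h']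
  interval_cases j
  · left; simp
  · right; simp [flip]

theorem rot_pow_eq_one_iff (i : ℕ) : rot s hs ^ i = 1 ↔ 2 ^ s ∣ i := by
  rw [rot_pow, ← map_one SemidirectProduct.inl, SemidirectProduct.inl_inj, ofAdd_eq_one,
    ZMod.natCast_eq_zero_iff]

theorem card : Nat.card (Semidihedral s hs) = 2 ^ (s + 1) := by
  rw [SemidirectProduct.card]
  simp [pow_succ]

instance : Finite (Semidihedral s hs) :=
  Nat.finite_of_card_ne_zero (by rw [card]; positivity)

/-- The unique central involution. -/
def negOne (s : ℕ) (hs : 3 ≤ s) : Semidihedral s hs := rot s hs ^ 2 ^ (s - 1)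

theorem negOne_sq : negOne s hs ^ 2 = 1 := by
  rw [negOne, ← pow_mul, mul_comm, ← two_pow_eq s hs, rot_pow_two_pow]

theorem negOne_ne_one : negOne s hs ≠ 1 := by
  rw [negOne, Ne, rot_pow_eq_one_iff]
  intro h
  have := Nat.le_of_dvd (by positivity) h
  rw [two_pow_eq s hs] at this
  have : 0 < 2 ^ (s - 1) := by positivity
  omega

theorem eq_one_or_eq_negOne_of_commute {g : Semidihedral s hs} (h₁ : Commute g (rot s hs))
    (h₂ : Commute g (flip s hs)) : g = 1 ∨ g = negOne s hs := by
  have hpos : 0 < 2 ^ (s - 2) := by positivity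
  have e₁ : 2 ^ (s - 1) = 2 * 2 ^ (s - 2) := by
    rw [← pow_succ']; congr 1; omega
  have e₂ := two_pow_eq s hs
  have e₃ := twistExp_add_one s
  have e₄ : 2 ^ (s - 2) = 2 * 2 ^ (s - 3) := by
    rw [← pow_succ']; congr 1; omega
  have hpos' : 0 < 2 ^ (s - 3) := by positivity
  obtain ⟨i, hi, rfl | rfl⟩ := exists_eq g
  · have h : (rot s hs ^ i) = rot s hs ^ (twistExp s * i) := by
      calc rot s hs ^ i = (flip s hs)⁻¹ * rot s hs ^ i * flip s hs := by
            rw [mul_assoc, h₂.eq, inv_mul_cancel_left]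
        _ = ((flip s hs)⁻¹ * rot s hs * flip s hs) ^ i := by
            have := conj_pow (a := (flip s hs)⁻¹) (b := rot s hs) (i := i)
            rw [inv_inv] at this
            exact this.symm
        _ = _ := by rw [flip_rot_flip, pow_mul]
    have h' : rot s hs ^ ((twistExp s - 1) * i) = 1 := by
      have : twistExp s * i = (twistExp s - 1) * i + i := by
        rw [← Nat.succ_mul]; congr 1; omega
      rw [this, pow_add] at h
      exact (mul_eq_right.mp h.symm)
    rw [rot_pow_eq_one_iff] at h'
    have e₅ : twistExp s - 1 = 2 * (2 ^ (s - 2) - 1) := by omega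
    rw [e₅, e₂, mul_assoc] at h'
    have h₆ : 2 ^ (s - 1) ∣ (2 ^ (s - 2) - 1) * i := Nat.dvd_of_mul_dvd_mul_left two_pos h'
    have h₇ : 2 ^ (s - 1) ∣ i := by
      refine (Nat.Coprime.pow_left _ ?_).dvd_of_dvd_mul_left h₆
      rw [Nat.coprime_two_left, Nat.odd_iff]
      omega
    obtain ⟨j, rfl⟩ := h₇
    have hj : j < 2 := by
      by_contra hj
      have : 2 ^ (s - 1) * 2 ≤ 2 ^ (s - 1) * j := Nat.mul_le_mul_left _ (by omega)
      omega
    interval_cases j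
    · left; simp
    · right; simp [negOne]
  · exfalso
    have h : Commute (flip s hs) (rot s hs) := by
      have := ((Commute.refl (rot s hs)).pow_left i).inv_left.mul_left h₁
      rwa [inv_mul_cancel_left] at this
    have h' := flip_rot_flip (s := s) (hs := hs)
    rw [mul_assoc, ← h.eq, inv_mul_cancel_left] at h'
    have h'' : rot s hs ^ (twistExp s - 1) = 1 := by
      have : twistExp s = (twistExp s - 1) + 1 := by omega
      rw [this, pow_succ] at h'
      exact mul_eq_right.mp h'.symm
    rw [rot_pow_eq_one_iff] at h''
    have := Nat.le_of_dvd (by omega) h''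
    omega

end Semidihedral

section PlaneRep

open Matrix

theorem companion_pow_mul {R : Type*} [CommRing R] (e e' : R) (n : ℕ) :
    (!![0, 1; -(e * e'), e + e'] : Matrix (Fin 2) (Fin 2) R) ^ n * !![1, 1; e, e'] =
      !![1, 1; e, e'] * !![e ^ n, 0; 0, e' ^ n] := by
  induction n with
  | zero => simp [← Matrix.one_fin_two]
  | succ n ih =>
    have h : (!![0, 1; -(e * e'), e + e'] : Matrix (Fin 2) (Fin 2) R) * !![1, 1; e, e'] =
        !![1, 1; e, e'] * !![e, 0; 0, e'] := by
      ext i j; fin_cases i <;> fin_cases j <;> simp [Matrix.mul_apply, Fin.sum_univ_two] <;> ring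
    rw [pow_succ, mul_assoc, h, ← mul_assoc, ih, mul_assoc]
    congr 1
    ext i j; fin_cases i <;> fin_cases j <;> simp [Matrix.mul_apply, Fin.sum_univ_two, pow_succ]

theorem companion_pow_eq_smul {K : Type*} [Field K] {e e' : K} (h : e' ≠ e) {n : ℕ} {a : K}
    (he : e ^ n = a) (he' : e' ^ n = a) :
    (!![0, 1; -(e * e'), e + e'] : Matrix (Fin 2) (Fin 2) K) ^ n = a • 1 := by
  have hV : IsUnit (!![1, 1; e, e'] : Matrix (Fin 2) (Fin 2) K) := by
    rw [Matrix.isUnit_iff_isUnit_det, Matrix.det_fin_two_of, isUnit_iff_ne_zero]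
    simpa [sub_eq_zero] using h
  rw [← hV.mul_left_inj, companion_pow_mul, he, he']
  ext i j; fin_cases i <;> fin_cases j <;> simp [Matrix.mul_apply, Fin.sum_univ_two] <;> ring

variable {L L' : Type*} [Field L] [Field L'] [Algebra L L'] {s : ℕ} {hs : 3 ≤ s}

theorem exists_semidihedral_rep (hs : 3 ≤ s) {e : L'} {c δ : L} (he : e ^ 2 ^ s = 1)
    (hc : algebraMap L L' c = e + e ^ twistExp s) (hδ : algebraMap L L' δ = e ^ 2 ^ (s - 1))
    (hne : e ^ twistExp s ≠ e) :
    ∃ ρ : Semidihedral s hs →* GL (Fin 2) L,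
      (∀ i, ρ (Semidihedral.rot s hs ^ i) = 1 ↔ e ^ i = 1) ∧
      (∀ i, ρ (Semidihedral.rot s hs ^ i * Semidihedral.flip s hs) ≠ 1) ∧
      (ρ (Semidihedral.negOne s hs)).val = δ • 1 := by
  set φ := algebraMap L L'
  set e' := e ^ twistExp s with he'
  have hφ : Function.Injective φ := φ.injective
  have hmul : e * e' = φ δ := by rw [hδ, he', ← pow_succ', twistExp_add_one]
  have hδ2 : δ * δ = 1 := by
    apply hφ
    rw [map_mul, map_one, hδ, ← pow_add, ← two_mul, ← two_pow_eq s hs, he]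
  have hodd : ∃ j, twistExp s = 2 * j + 1 := by
    have h1 := twistExp_add_one s
    have h2 : 2 ^ (s - 1) = 2 * 2 ^ (s - 2) := by rw [← pow_succ']; congr 1; omega
    have h3 : 0 < 2 ^ (s - 2) := by positivity
    exact ⟨2 ^ (s - 2) - 1, by omega⟩
  have he'N : e' ^ 2 ^ (s - 1) = φ δ := by
    obtain ⟨j, hj⟩ := hodd
    rw [he', ← pow_mul, mul_comm, pow_mul, ← hδ, hj, ← map_pow, pow_succ, pow_mul, sq, hδ2,
      one_pow, one_mul]
  let X₀ : Matrix (Fin 2) (Fin 2) L := !![0, 1; -δ, c]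
  let Y₀ : Matrix (Fin 2) (Fin 2) L := !![1, 0; c, -1]
  have hX₀ : X₀.map φ = !![0, 1; -(e * e'), e + e'] := by
    ext i j; fin_cases i <;> fin_cases j <;> simp [X₀, hmul, hc]
  have hYY : Y₀ * Y₀ = 1 := by
    ext i j; fin_cases i <;> fin_cases j <;> simp [Y₀, Matrix.mul_apply, Fin.sum_univ_two]
  have hmapinj : Function.Injective (φ.mapMatrix (m := Fin 2)) :=
    fun A B h => Matrix.map_injective hφ h
  have hXmap (n : ℕ) : φ.mapMatrix (X₀ ^ n) = !![0, 1; -(e * e'), e + e'] ^ n := by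
    rw [map_pow, RingHom.mapMatrix_apply, hX₀]
  have hXN : X₀ ^ 2 ^ (s - 1) = δ • 1 := by
    apply hmapinj
    rw [hXmap, companion_pow_eq_smul hne hδ.symm he'N]
    ext i j; simp [Matrix.map_apply, Matrix.one_apply, apply_ite φ]
  let Xi : Matrix (Fin 2) (Fin 2) L := !![δ * c, -δ; 1, 0]
  have hXXi : X₀ * Xi = 1 := by
    ext i j; fin_cases i <;> fin_cases j <;>
      simp [X₀, Xi, Matrix.mul_apply, Fin.sum_univ_two, hδ2]
    linear_combination (-c) * hδ2
  have hXiX : Xi * X₀ = 1 := mul_eq_one_comm.mp hXXi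
  let X : GL (Fin 2) L := ⟨X₀, Xi, hXXi, hXiX⟩
  let Y : GL (Fin 2) L := ⟨Y₀, Y₀, hYY, hYY⟩
  have hX : X ^ 2 ^ s = 1 := by
    apply Units.ext
    rw [two_pow_eq s hs, mul_comm, pow_mul, Units.val_pow_eq_pow_val, Units.val_pow_eq_pow_val]
    change (X₀ ^ _) ^ 2 = 1
    rw [hXN, sq]
    simp [smul_smul, hδ2]
  have hY : Y ^ 2 = 1 := by
    apply Units.ext
    rw [sq]; exact hYY
  have hYXY : Y * X * Y⁻¹ = X ^ twistExp s := by
    rw [eq_comm, ← mul_left_inj X, ← pow_succ, twistExp_add_one]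
    apply Units.ext
    rw [Units.val_pow_eq_pow_val]
    change X₀ ^ _ = Y₀ * X₀ * Y₀ * X₀
    rw [hXN]
    ext i j; fin_cases i <;> fin_cases j <;>
      simp [X₀, Y₀, Matrix.mul_apply, Fin.sum_univ_two]
  have hconj : ∀ g : Multiplicative (ZMod 2),
      (cyclicLift (2 ^ s) X hX).comp
        (MulEquiv.toMonoidHom (cyclicLift 2 (twistAut s hs) (twistAut_sq s hs) g)) =
      (MulEquiv.toMonoidHom (MulAut.conj (cyclicLift 2 Y hY g))).comp
        (cyclicLift (2 ^ s) X hX) := by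
    intro g
    obtain ⟨j, hj, rfl⟩ := exists_natCast_ofAdd 2 g
    interval_cases j
    · ext a; simp
    · apply MonoidHom.ext
      intro a
      obtain ⟨i, hi, rfl⟩ := exists_natCast_ofAdd (2 ^ s) a
      simp only [cyclicLift_ofAdd_natCast, pow_one, MonoidHom.comp_apply,
        MulEquiv.coe_toMonoidHom, MulAut.conj_apply]
      change cyclicLift (2 ^ s) X hX ((Multiplicative.ofAdd (i : ZMod (2 ^ s))) ^ twistExp s) = _
      rw [map_pow, cyclicLift_ofAdd_natCast, ← conj_pow, hYXY, ← pow_mul, ← pow_mul, mul_comm]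
  let ρ : Semidihedral s hs →* GL (Fin 2) L :=
    SemidirectProduct.lift (cyclicLift (2 ^ s) X hX) (cyclicLift 2 Y hY) hconj
  have hρX : ρ (Semidihedral.rot s hs) = X := by
    have := cyclicLift_ofAdd_natCast (2 ^ s) X hX 1
    simpa [ρ, Semidihedral.rot] using this
  have hρY : ρ (Semidihedral.flip s hs) = Y := by
    have := cyclicLift_ofAdd_natCast 2 Y hY 1
    simpa [ρ, Semidihedral.flip] using this
  refine ⟨ρ, fun i => ?_, fun i h => ?_, ?_⟩
  · rw [map_pow, hρX]
    constructor
    · intro h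
      have h1 : X₀ ^ i = 1 := by
        have := congrArg Units.val h
        rwa [Units.val_pow_eq_pow_val] at this
      have h2 := companion_pow_mul e e' i
      rw [← hXmap, h1] at h2
      have := congrFun (congrFun h2 0) 0
      simpa [Matrix.mul_apply, Fin.sum_univ_two] using this.symm
    · intro h
      apply Units.ext
      rw [Units.val_pow_eq_pow_val]
      change X₀ ^ i = 1
      apply hmapinj
      rw [hXmap, companion_pow_eq_smul hne h (by rw [he', pow_right_comm, h, one_pow])]
      simp
  · rw [map_mul, map_pow, hρX, hρY] at h
    have h1 : X₀ ^ i * Y₀ = 1 := by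
      have := congrArg Units.val h
      rwa [Units.val_mul, Units.val_pow_eq_pow_val] at this
    have hYV : φ.mapMatrix Y₀ * !![1, 1; e, e'] = !![1, 1; e, e'] * !![0, 1; 1, 0] := by
      ext i j; fin_cases i <;> fin_cases j <;>
        simp [Y₀, Matrix.mul_apply, Fin.sum_univ_two, hc]
    have h2 : φ.mapMatrix (X₀ ^ i * Y₀) * !![1, 1; e, e'] = !![1, 1; e, e'] := by
      rw [h1]; simp
    rw [map_mul, hXmap, mul_assoc, hYV, ← mul_assoc, companion_pow_mul] at h2
    have h3 := congrFun (congrFun h2 0) 0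
    have h4 := congrFun (congrFun h2 1) 0
    simp [Matrix.mul_apply, Fin.sum_univ_two] at h3 h4
    rw [h3, mul_one] at h4
    exact hne h4
  · rw [Semidihedral.negOne, map_pow, hρX, Units.val_pow_eq_pow_val]
    exact hXN

end PlaneRep

section Wreath

/-- The permutational wreath product of `S` and `R`, for `R` acting on `ι`. -/
abbrev PermWreath (S R ι : Type*) [Group S] [Group R] [MulAction R ι] : Type _ :=
  (ι → S) ⋊[mulAutArrow (G := R) (A := ι) (M := S)] R

namespace PermWreath

variable {S R ι L : Type*} [Group S] [Group R] [MulAction R ι] [Field L]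

theorem mul_left_apply (g h : PermWreath S R ι) (i : ι) :
    (g * h).left i = g.left i * h.left (g.right⁻¹ • i) := rfl

/-- The diagonal element attached to `z`. -/
def const (R ι : Type*) [Group R] [MulAction R ι] (z : S) : PermWreath S R ι :=
  SemidirectProduct.inl fun _ => z

theorem eq_const {z : S} {g : PermWreath S R ι} (hr : g.right = 1) (hl : ∀ i, g.left i = z) :
    g = const R ι z :=
  SemidirectProduct.ext (funext hl) hr

theorem const_one : const R ι (1 : S) = 1 := rfl

variable [Fintype ι] [DecidableEq ι]

/-- The block monomial matrices attached to a two-dimensional representation of `S`. -/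
def monomial (ρ : S →* GL (Fin 2) L) : PermWreath S R ι →* Matrix (ι × Fin 2) (ι × Fin 2) L where
  toFun g := Matrix.of fun u v => if u.1 = g.right • v.1 then (ρ (g.left u.1)).val u.2 v.2 else 0
  map_one' := by
    ext ⟨i, a⟩ ⟨j, b⟩
    by_cases h : i = j <;> simp [Matrix.one_apply, h]
  map_mul' g h := by
    ext ⟨i, a⟩ ⟨j, b⟩
    rw [Matrix.mul_apply, Fintype.sum_prod_type, Finset.sum_eq_single (g.right⁻¹ • i)]
    all_goals simp only [Matrix.of_apply]
    · have e : (i = (g * h).right • j) ↔ (g.right⁻¹ • i = h.right • j) := by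
        rw [SemidirectProduct.mul_right, mul_smul, inv_smul_eq_iff]
      by_cases hij : i = (g * h).right • j
      · have hij' := e.mp hij
        simp only [if_pos hij, smul_inv_smul, if_true, if_pos hij', mul_left_apply, map_mul,
          Units.val_mul, Matrix.mul_apply]
      · simp only [if_neg hij, if_neg (fun h' => hij (e.mpr h')), mul_zero,
          Finset.sum_const_zero]
    · intro k _ hk
      refine Finset.sum_eq_zero fun c _ => ?_
      have : ¬ i = g.right • k := fun h' => hk (by rw [h', inv_smul_smul])
      simp [this]
    · simp

theorem monomial_apply (ρ : S →* GL (Fin 2) L) (g : PermWreath S R ι) (u v : ι × Fin 2) :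
    monomial ρ g u v = if u.1 = g.right • v.1 then (ρ (g.left u.1)).val u.2 v.2 else 0 := rfl

theorem monomial_const (ρ : S →* GL (Fin 2) L) {z : S} {c : L} (hz : (ρ z).val = c • 1) :
    monomial ρ (const R ι z) = c • 1 := by
  ext ⟨i, a⟩ ⟨j, b⟩
  simp only [monomial_apply, const, SemidirectProduct.left_inl, SemidirectProduct.right_inl,
    one_smul, hz, Matrix.smul_apply, smul_eq_mul, Matrix.one_apply, Prod.mk.injEq]
  by_cases h : i = j <;> simp [h]

/-- The monomial matrices as invertible matrices. -/
noncomputable def monomialGL (ρ : S →* GL (Fin 2) L) : PermWreath S R ι →* GL (ι × Fin 2) L :=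
  (monomial ρ).toHomUnits

variable [FaithfulSMul R ι]

theorem right_eq_one_of_monomial_diagonal {ρ : S →* GL (Fin 2) L} {g : PermWreath S R ι}
    (h : ∀ u v, u ≠ v → monomial ρ g u v = 0) : g.right = 1 := by
  apply FaithfulSMul.eq_of_smul_eq_smul (α := ι)
  intro i
  rw [one_smul]
  by_contra hi
  have h0 : (ρ (g.left (g.right • i))).val = 0 := by
    ext a b
    have := h (g.right • i, a) (i, b) (fun e => hi (congrArg Prod.fst e))
    simpa [monomial_apply] using this
  exact (ρ (g.left (g.right • i))).ne_zero h0

/-- A monomial matrix acting by a scalar on each block comes from central elements of `S`. -/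
theorem left_eq_of_monomial_diagonal {ρ : S →* GL (Fin 2) L} (hρ : Function.Injective ρ)
    {z : S} (hz : (ρ z).val = (-1 : L) • 1) (hcen : ∀ g : S, (∀ h, Commute g h) → g = 1 ∨ g = z)
    {g : PermWreath S R ι} {d : ι → L} (h : monomial ρ g = Matrix.diagonal fun u => d u.1) :
    g.right = 1 ∧ ∀ i, (g.left i = 1 ∧ d i = 1) ∨ (g.left i = z ∧ d i = -1) := by
  have hr : g.right = 1 := right_eq_one_of_monomial_diagonal (ρ := ρ) fun u v huv => by
    rw [h, Matrix.diagonal_apply_ne _ huv]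
  refine ⟨hr, fun i => ?_⟩
  have hi : (ρ (g.left i)).val = d i • 1 := by
    ext a b
    have := congrFun (congrFun h (i, a)) (i, b)
    simpa [monomial_apply, hr, Matrix.diagonal_apply, Matrix.one_apply] using this
  rcases hcen (g.left i) (fun x => hρ (by
    rw [map_mul, map_mul]; apply Units.ext; rw [Units.val_mul, Units.val_mul, hi]; simp)) with h1 | h1
  · left
    refine ⟨h1, ?_⟩
    rw [h1, map_one] at hi
    simpa using (congrFun (congrFun hi 0) 0).symm
  · right
    refine ⟨h1, ?_⟩
    rw [h1, hz] at hi
    simpa using (congrFun (congrFun hi 0) 0).symm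

theorem monomialGL_mem_center_iff [Nonempty ι] {ρ : S →* GL (Fin 2) L}
    (hρ : Function.Injective ρ) {z : S} (hz : (ρ z).val = (-1 : L) • 1)
    (hcen : ∀ g : S, (∀ h, Commute g h) → g = 1 ∨ g = z) (hneg : (-1 : L) ≠ 1)
    (g : PermWreath S R ι) :
    monomialGL ρ g ∈ Subgroup.center (GL (ι × Fin 2) L) ↔ g = 1 ∨ g = const R ι z := by
  rw [Matrix.GeneralLinearGroup.mem_center_iff_val_mem_range_scalar]
  constructor
  · rintro ⟨c, hc⟩
    obtain ⟨hr, hl⟩ := left_eq_of_monomial_diagonal (g := g) (d := fun _ => c) hρ hz hcen hc.symm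
    by_cases h1 : c = 1
    · left
      rw [← const_one]
      refine eq_const hr fun i => ?_
      rcases hl i with h | h
      · exact h.1
      · exact absurd (h.2.symm.trans h1) hneg
    · right
      refine eq_const hr fun i => ?_
      rcases hl i with h | h
      · exact absurd h.2 h1
      · exact h.1
  · rintro (rfl | rfl)
    · exact ⟨1, by simp⟩
    · refine ⟨-1, ?_⟩
      change _ = monomial ρ (const R ι z)
      rw [monomial_const ρ hz]
      ext i j
      simp [Matrix.one_apply, Matrix.diagonal_apply]

end PermWreath

end Wreath

section BipartiteForms

open Matrix

variable {I E : Type*} [Fintype I] [DecidableEq I] [Field E]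

/-- Symmetric matrices vanishing on pairs of indices of equal colour. -/
def bipartiteForms (E : Type*) [Field E] (p : I → Bool) : Submodule E (Matrix I I E) where
  carrier := {T | Tᵀ = T ∧ ∀ u v, p u = p v → T u v = 0}
  add_mem' := fun {S T} hS hT => ⟨by rw [transpose_add, hS.1, hT.1], fun u v h => by
    rw [Matrix.add_apply, hS.2 u v h, hT.2 u v h, add_zero]⟩
  zero_mem' := ⟨transpose_zero, fun _ _ _ => rfl⟩
  smul_mem' := fun c T hT => ⟨by rw [transpose_smul, hT.1], fun u v h => by
    rw [Matrix.smul_apply, hT.2 u v h, smul_zero]⟩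

omit [Fintype I] [DecidableEq I] in
theorem bipartiteForms_symm {p : I → Bool} (T : bipartiteForms E p) (u v : I) :
    T.1 u v = T.1 v u := congrFun (congrFun T.2.1 v) u

/-- A bipartite form is determined by its upper right block. -/
def bipartiteFormsEquiv (E : Type*) [Field E] (p : I → Bool) : bipartiteForms E p ≃ₗ[E]
    Matrix {u // p u = true} {v // ¬ p v = true} E where
  toFun T := Matrix.of fun u v => T.1 u v
  map_add' _ _ := rfl
  map_smul' _ _ := rfl
  invFun A := ⟨Matrix.of fun u v =>
    if hu : p u = true then (if hv : p v = true then 0 else A ⟨u, hu⟩ ⟨v, hv⟩)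
    else (if hv : p v = true then A ⟨v, hv⟩ ⟨u, hu⟩ else 0), by
      constructor
      · ext u v
        by_cases hu : p u = true <;> by_cases hv : p v = true <;> simp [hu, hv]
      · intro u v h
        by_cases hu : p u = true
        · simp [hu, ← h]
        · simp [hu, ← h]⟩
  left_inv T := by
    apply Subtype.ext
    ext u v
    by_cases hu : p u = true <;> by_cases hv : p v = true <;> simp [hu, hv]
    · exact (T.2.2 u v (hu.trans hv.symm)).symm
    · exact bipartiteForms_symm T v u
    · exact (T.2.2 u v (by simp [hu, hv])).symm
  right_inv A := by
    ext u v
    simp [u.2, v.2]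

omit [DecidableEq I] in
theorem finrank_bipartiteForms (p : I → Bool) : Module.finrank E (bipartiteForms E p) =
    Fintype.card {u // p u = true} * Fintype.card {v // ¬ p v = true} := by
  rw [(bipartiteFormsEquiv E p).finrank_eq, Module.finrank_matrix]
  simp

theorem diagonal_of_fixes_bipartiteForms {p : I → Bool} {g : Matrix I I E} (hg : IsUnit g)
    (hT : ∀ T ∈ bipartiteForms E p, g * T * gᵀ = T)
    (h₁ : ∀ u, p u = true → ∃ u', u' ≠ u ∧ p u' = true)
    (h₂ : ∀ v, p v = false → ∃ v', v' ≠ v ∧ p v' = false)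
    (h₃ : ∃ u, p u = true) (h₄ : ∃ v, p v = false) :
    (∀ u v, u ≠ v → g u v = 0) ∧ ∀ u v, p u = true → p v = false → g u u * g v v = 1 := by
  have entry : ∀ u v, p u = true → p v = false → ∀ w y,
      g w u * g y v + g w v * g y u =
        (single u v (1 : E) + single v u (1 : E)) w y := by
    intro u v hu hv w y
    have hmem : (single u v (1 : E) + single v u (1 : E)) ∈ bipartiteForms E p := by
      constructor
      · rw [transpose_add, transpose_single, transpose_single, add_comm]
      · intro a b hab
        simp only [Matrix.add_apply, single_apply]
        have ha : ¬ (u = a ∧ v = b) := by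
          rintro ⟨rfl, rfl⟩; rw [hu, hv] at hab; exact absurd hab (by simp)
        have hb : ¬ (v = a ∧ u = b) := by
          rintro ⟨rfl, rfl⟩; rw [hu, hv] at hab; exact absurd hab (by simp)
        simp [ha, hb]
    have := congrFun (congrFun (hT _ hmem) w) y
    rw [← this, mul_add, add_mul, Matrix.add_apply]
    congr 1
    · simp [Matrix.mul_apply, single_apply, ite_and]
    · simp [Matrix.mul_apply, single_apply, ite_and]
  have hinj : Function.Injective g.mulVec := Matrix.mulVec_injective_iff_isUnit.mpr hg
  have van : ∀ u v, p u = true → p v = false → ∀ w, w ≠ u → w ≠ v → g w u = 0 ∧ g w v = 0 := by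
    intro u v hu hv w hwu hwv
    have huv : u ≠ v := fun e => by rw [e, hv] at hu; exact absurd hu (by simp)
    have h0 : g.mulVec (Pi.single v (g w u) + Pi.single u (g w v)) = g.mulVec 0 := by
      ext y
      have := entry u v hu hv w y
      rw [Matrix.add_apply, single_apply_of_row_ne hwu.symm, single_apply_of_row_ne hwv.symm,
        add_zero] at this
      rw [mulVec_add, mulVec_zero, Pi.add_apply, mulVec_single, mulVec_single]
      simpa [mul_comm] using this
    have h1 := hinj h0
    constructor
    · simpa [huv.symm] using congrFun h1 v
    · simpa [huv] using congrFun h1 u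
  have hdiag : ∀ u v, u ≠ v → g u v = 0 := by
    intro w u hwu
    by_cases hu : p u = true
    · obtain ⟨v, hv⟩ := h₄
      by_cases hwv : w = v
      · obtain ⟨v', hv', hpv'⟩ := h₂ v hv
        exact (van u v' hu hpv' w hwu (fun e => hv' (e.symm.trans hwv))).1
      · exact (van u v hu hv w hwu hwv).1
    · have hu' : p u = false := by simpa using hu
      obtain ⟨v, hv⟩ := h₃
      by_cases hwv : w = v
      · obtain ⟨v', hv', hpv'⟩ := h₁ v hv
        exact (van v' u hpv' hu' w (fun e => hv' (e.symm.trans hwv)) hwu).2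
      · exact (van v u hv hu' w hwv hwu).2
  refine ⟨hdiag, fun u v hu hv => ?_⟩
  have huv : u ≠ v := fun e => by rw [e, hv] at hu; exact absurd hu (by simp)
  have := entry u v hu hv u v
  rw [hdiag u v huv, zero_mul, add_zero] at this
  rw [this]
  simp [huv]

end BipartiteForms

section BipartiteRep

open Matrix

namespace PermWreath

variable {S R ι E : Type*} [Group S] [Group R] [MulAction R ι] [Field E] [Fintype ι]
  [DecidableEq ι]

theorem monomial_mul_mem {B : ι → Bool} (hB : ∀ (r : R) i j, B (r • i) = B (r • j) → B i = B j)
    (ρ : S →* GL (Fin 2) E) (g : PermWreath S R ι) {T : Matrix (ι × Fin 2) (ι × Fin 2) E}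
    (hT : T ∈ bipartiteForms E fun u : ι × Fin 2 => B u.1) :
    monomial ρ g * T * (monomial ρ g)ᵀ ∈ bipartiteForms E fun u : ι × Fin 2 => B u.1 := by
  constructor
  · rw [transpose_mul, transpose_mul, transpose_transpose, hT.1, mul_assoc]
  · intro u v huv
    rw [Matrix.mul_apply]
    refine Finset.sum_eq_zero fun b _ => ?_
    rw [Matrix.mul_apply, Finset.sum_mul]
    refine Finset.sum_eq_zero fun a _ => ?_
    rw [transpose_apply, monomial_apply, monomial_apply]
    split_ifs with h1 h2
    · rw [hT.2 a b (hB g.right _ _ (by rw [← h1, ← h2]; exact huv))]; simp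
    all_goals simp

/-- The action of the wreath product by congruence on bipartite forms. -/
def formRep {B : ι → Bool} (hB : ∀ (r : R) i j, B (r • i) = B (r • j) → B i = B j)
    (ρ : S →* GL (Fin 2) E) : PermWreath S R ι →*
      Module.End E (bipartiteForms E fun u : ι × Fin 2 => B u.1) where
  toFun g :=
    { toFun := fun T => ⟨monomial ρ g * T.1 * (monomial ρ g)ᵀ, monomial_mul_mem hB ρ g T.2⟩
      map_add' := fun T T' => Subtype.ext (by simp [mul_add, add_mul])
      map_smul' := fun c T => Subtype.ext (by simp) }
  map_one' := by ext T : 2; simp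
  map_mul' g h := by ext T : 2; simp [mul_assoc]

theorem formRep_eq_one_iff [FaithfulSMul R ι] {B : ι → Bool}
    (hB : ∀ (r : R) i j, B (r • i) = B (r • j) → B i = B j) {ρ : S →* GL (Fin 2) E}
    (hρ : Function.Injective ρ) {z : S} (hz : (ρ z).val = (-1 : E) • 1)
    (hcen : ∀ g : S, (∀ h, Commute g h) → g = 1 ∨ g = z) (hneg : (-1 : E) ≠ 1)
    (h₁ : ∃ i, B i = true) (h₂ : ∃ i, B i = false) (g : PermWreath S R ι) :
    formRep hB ρ g = 1 ↔ g = 1 ∨ g = const R ι z := by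
  constructor
  · intro h
    have hT : ∀ T ∈ bipartiteForms E fun u : ι × Fin 2 => B u.1,
        monomial ρ g * T * (monomial ρ g)ᵀ = T := fun T hT =>
      congrArg Subtype.val (LinearMap.congr_fun h ⟨T, hT⟩)
    obtain ⟨i₁, hi₁⟩ := h₁
    obtain ⟨i₂, hi₂⟩ := h₂
    have hother : ∀ u : ι × Fin 2, ∃ u' : ι × Fin 2, u' ≠ u ∧ u'.1 = u.1 := by
      rintro ⟨i, a⟩
      exact ⟨(i, a + 1), by fin_cases a <;> simp, rfl⟩
    obtain ⟨hd, hm⟩ := diagonal_of_fixes_bipartiteForms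
      (show IsUnit (monomial ρ g) from (monomialGL ρ g).isUnit) hT
      (fun u hu => by obtain ⟨u', h, h'⟩ := hother u; exact ⟨u', h, by rw [h', hu]⟩)
      (fun u hu => by obtain ⟨u', h, h'⟩ := hother u; exact ⟨u', h, by rw [h', hu]⟩)
      ⟨(i₁, 0), hi₁⟩ ⟨(i₂, 0), hi₂⟩
    set M := monomial ρ g
    let d : ι → E := fun i => M (i, 0) (i, 0)
    have hd' : M = Matrix.diagonal fun u => d u.1 := by
      ext u v
      by_cases huv : u = v
      · subst huv
        rw [Matrix.diagonal_apply_eq]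
        obtain ⟨i, a⟩ := u
        by_cases hi : B i = true
        · have e1 := hm (i, a) (i₂, 0) hi hi₂
          have e2 := hm (i, 0) (i₂, 0) hi hi₂
          exact mul_right_cancel₀ (right_ne_zero_of_mul_eq_one e1) (e1.trans e2.symm)
        · have hi' : B i = false := by simpa using hi
          have e1 := hm (i₁, 0) (i, a) hi₁ hi'
          have e2 := hm (i₁, 0) (i, 0) hi₁ hi'
          exact mul_left_cancel₀ (left_ne_zero_of_mul_eq_one e1) (e1.trans e2.symm)
      · rw [hd u v huv, Matrix.diagonal_apply_ne _ huv]
    obtain ⟨hr, hl⟩ := left_eq_of_monomial_diagonal hρ hz hcen hd'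
    have hprod : ∀ i j, B i = true → B j = false → d i * d j = 1 :=
      fun i j hi hj => hm (i, 0) (j, 0) hi hj
    have hall : ∀ i, d i = d i₁ := by
      have h2 : d i₂ = d i₁ := by
        have := hprod i₁ i₂ hi₁ hi₂
        rcases hl i₁ with ⟨-, h⟩ | ⟨-, h⟩ <;> rcases hl i₂ with ⟨-, h'⟩ | ⟨-, h'⟩ <;>
          rw [h, h'] at this ⊢
        · exact absurd (by simpa using this) hneg
        · exact absurd (by simpa using this) hneg
      intro i
      by_cases hi : B i = true
      · exact mul_right_cancel₀ (right_ne_zero_of_mul_eq_one (hprod i i₂ hi hi₂))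
          ((hprod i i₂ hi hi₂).trans (hprod i₁ i₂ hi₁ hi₂).symm)
      · have hi' : B i = false := by simpa using hi
        rw [← h2]
        exact mul_left_cancel₀ (left_ne_zero_of_mul_eq_one (hprod i₁ i hi₁ hi'))
          ((hprod i₁ i hi₁ hi').trans (hprod i₁ i₂ hi₁ hi₂).symm)
    rcases hl i₁ with ⟨-, h1⟩ | ⟨-, h1⟩
    · left
      rw [← const_one]
      refine eq_const hr fun i => ?_
      rcases hl i with h | h
      · exact h.1
      · exact absurd (h.2.symm.trans ((hall i).trans h1)) hneg
    · right
      refine eq_const hr fun i => ?_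
      rcases hl i with h | h
      · exact absurd (h1.symm.trans ((hall i).symm.trans h.2)) hneg
      · exact h.1
  · rintro (rfl | rfl)
    · exact map_one _
    · ext T : 2
      change monomial ρ (const R ι z) * T.1 * (monomial ρ (const R ι z))ᵀ = T.1
      rw [monomial_const ρ hz]
      simp

end PermWreath

end BipartiteRep

section Matrices

variable {k G V : Type*} [Field k] [Group G] [AddCommGroup V] [Module k V] [FiniteDimensional k V]

theorem exists_hom_GL_of_hom_end (f : G →* Module.End k V) {d : ℕ}
    (hd : Module.finrank k V = d) :
    ∃ φ : G →* Matrix.GeneralLinearGroup (Fin d) k, ∀ g, φ g = 1 ↔ f g = 1 := by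
  let b := Module.finBasisOfFinrankEq k V hd
  refine ⟨((LinearMap.toMatrixAlgEquiv b : Module.End k V →* Matrix (Fin d) (Fin d) k).comp
    f).toHomUnits, fun g => ?_⟩
  rw [← Units.val_inj]
  change LinearMap.toMatrixAlgEquiv b (f g) = 1 ↔ _
  rw [← map_one (LinearMap.toMatrixAlgEquiv b), (LinearMap.toMatrixAlgEquiv b).injective.eq_iff]

/-- Restriction of scalars on endomorphisms. -/
def endRestrictScalars (k E V : Type*) [Field k] [Field E] [Algebra k E] [AddCommGroup V]
    [Module k V] [Module E V] [IsScalarTower k E V] : Module.End E V →* Module.End k V where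
  toFun f := f.restrictScalars k
  map_one' := rfl
  map_mul' _ _ := rfl

theorem exists_hom_GL_of_hom_end_extension {E : Type*} [Field E] [Algebra k E]
    [FiniteDimensional k E] [Module E V] [IsScalarTower k E V]
    (f : G →* Module.End E V) {d : ℕ} (hd : Module.finrank k E * Module.finrank E V = d) :
    ∃ φ : G →* Matrix.GeneralLinearGroup (Fin d) k, ∀ g, φ g = 1 ↔ f g = 1 := by
  obtain ⟨φ, hφ⟩ := exists_hom_GL_of_hom_end ((endRestrictScalars k E V).comp f)
    ((Module.finrank_mul_finrank k E V).symm.trans hd)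
  refine ⟨φ, fun g => (hφ g).trans ?_⟩
  change (f g).restrictScalars k = (1 : Module.End E V).restrictScalars k ↔ _
  exact (LinearMap.restrictScalars_injective k).eq_iff

end Matrices

section SylowTransfer

variable {G H M : Type*} [Group G] [Group H] [Group M] {p : ℕ} [Fact p.Prime]

theorem injective_rangeLift {Φ : G →* H} {φ : G →* M} (h : ∀ g, φ g = 1 ↔ Φ g = 1) :
    ∃ f : Φ.range →* M, Function.Injective f := by
  have hk : Φ.ker = φ.ker := by
    ext g; rw [MonoidHom.mem_ker, MonoidHom.mem_ker, h]
  exact ⟨((QuotientGroup.kerLift φ).comp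
    (QuotientGroup.quotientMulEquivOfEq hk).toMonoidHom).comp
    (QuotientGroup.quotientKerEquivRange Φ).symm.toMonoidHom,
    (QuotientGroup.kerLift_injective φ).comp ((MulEquiv.injective _).comp (MulEquiv.injective _))⟩

theorem exists_injective_of_range_card [Finite H] (P : Sylow p H) {Φ : G →* H}
    (hcard : Nat.card Φ.range = p ^ (Nat.card H).factorization p) {φ : G →* M}
    (h : ∀ g, φ g = 1 ↔ Φ g = 1) : ∃ f : P →* M, Function.Injective f := by
  obtain ⟨f, hf⟩ := injective_rangeLift h
  let e : P ≃* (Sylow.ofCard Φ.range hcard) := P.equiv _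
  exact ⟨f.comp e.toMonoidHom, hf.comp e.injective⟩

theorem exists_hom_of_injective [Finite H] (hG : IsPGroup p G) (P : Sylow p H) (Φ : G →* H)
    {θ : P →* M} (hθ : Function.Injective θ) : ∃ φ : G →* M, ∀ g, φ g = 1 ↔ Φ g = 1 := by
  have hr : IsPGroup p Φ.range := hG.of_surjective Φ.rangeRestrict Φ.rangeRestrict_surjective
  obtain ⟨Q, hQ⟩ := hr.exists_le_sylow
  let e : Q ≃* P := Q.equiv P
  refine ⟨(θ.comp e.toMonoidHom).comp ((Subgroup.inclusion hQ).comp Φ.rangeRestrict), fun g => ?_⟩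
  have hinj : Function.Injective ((θ.comp e.toMonoidHom).comp (Subgroup.inclusion hQ)) :=
    (hθ.comp e.injective).comp (Subgroup.inclusion_injective hQ)
  change ((θ.comp e.toMonoidHom).comp (Subgroup.inclusion hQ)) (Φ.rangeRestrict g) = 1 ↔ _
  rw [map_eq_one_iff _ hinj]
  exact Subtype.ext_iff

theorem card_range_mul_card_ker (Φ : G →* H) :
    Nat.card Φ.range * Nat.card Φ.ker = Nat.card G := by
  rw [← Nat.card_congr (QuotientGroup.quotientKerEquivRange Φ).toEquiv, mul_comm]
  exact (Subgroup.card_mul_index Φ.ker)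

theorem minFaithfulDim_congr (k : Type*) [Field k] (e : G ≃* H) :
    minFaithfulDim k G = minFaithfulDim k H := by
  unfold minFaithfulDim
  congr 1
  ext d
  exact ⟨fun ⟨φ, h⟩ => ⟨φ.comp e.symm.toMonoidHom, h.comp e.symm.injective⟩,
    fun ⟨φ, h⟩ => ⟨φ.comp e.toMonoidHom, h.comp e.injective⟩⟩

/-- The minimal faithful dimension of a Sylow subgroup, from a model of a Sylow subgroup
and of a subgroup of it. -/
theorem minFaithfulDim_sylow_eq {G' : Type*} [Group G'] [Finite H] (P : Sylow p H)
    {k : Type*} [Field k] {d : ℕ} {Φ : G →* H}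
    (hcard : Nat.card Φ.range = p ^ (Nat.card H).factorization p)
    {φ : G →* Matrix.GeneralLinearGroup (Fin d) k} (hφ : ∀ g, φ g = 1 ↔ Φ g = 1)
    (hG' : IsPGroup p G') (Φ' : G' →* H)
    (hlow : ∀ d' : ℕ, ∀ ψ : G' →* Matrix.GeneralLinearGroup (Fin d') k,
      (∀ g, ψ g = 1 ↔ Φ' g = 1) → d ≤ d') : minFaithfulDim k P = d := by
  apply le_antisymm
  · exact Nat.sInf_le (exists_injective_of_range_card P hcard hφ)
  · refine le_csInf ⟨d, exists_injective_of_range_card P hcard hφ⟩ ?_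
    rintro d' ⟨θ, hθ⟩
    obtain ⟨ψ, hψ⟩ := exists_hom_of_injective hG' P Φ' hθ
    exact hlow d' ψ hψ

end SylowTransfer

section GLOrder

theorem padicValNat_pow_sub_one_of_odd {q j : ℕ} (hq4 : q % 4 = 3) (hj : Odd j) :
    padicValNat 2 (q ^ j - 1) = 1 := by
  have h : q ^ j % 4 = 3 := by
    obtain ⟨i, rfl⟩ := hj
    rw [pow_succ, pow_mul, Nat.mul_mod, Nat.pow_mod, Nat.pow_mod q, hq4]
    norm_num
  obtain ⟨u, hu⟩ : ∃ u, q ^ j - 1 = 2 * (2 * u + 1) := ⟨q ^ j / 4, by omega⟩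
  rw [hu, padicValNat.mul (by norm_num) (by omega), padicValNat.self (by norm_num),
    padicValNat.eq_zero_of_not_dvd (by omega)]

theorem padicValNat_pow_sub_one_of_even {q j : ℕ} (hq4 : q % 4 = 3) (hj : j ≠ 0) :
    padicValNat 2 (q ^ (2 * j) - 1) = padicValNat 2 (q + 1) + 1 + padicValNat 2 j := by
  have h := padicValNat.pow_two_sub_pow (x := q) (y := 1) (n := 2 * j) (by omega) (by omega)
    (by omega) (by omega) (even_two_mul j)
  have h1 := padicValNat_pow_sub_one_of_odd hq4 (j := 1) (by decide)
  rw [pow_one] at h1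
  rw [one_pow, h1, padicValNat.mul (by norm_num) hj, padicValNat.self (by norm_num)] at h
  omega

theorem padicValNat_prod {α : Type*} (t : Finset α) (f : α → ℕ) (hf : ∀ a ∈ t, f a ≠ 0) :
    padicValNat 2 (∏ a ∈ t, f a) = ∑ a ∈ t, padicValNat 2 (f a) := by
  classical
  induction t using Finset.induction_on with
  | empty => simp
  | insert a t ha ih =>
    rw [Finset.prod_insert ha, Finset.sum_insert ha, padicValNat.mul (hf a (by simp))
      (Finset.prod_ne_zero_iff.mpr fun b hb => hf b (by simp [hb])),
      ih fun b hb => hf b (by simp [hb])]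

variable {F : Type*} [Field F] [Fintype F]

theorem padicValNat_card_GL (hq4 : Fintype.card F % 4 = 3) (n : ℕ) :
    padicValNat 2 (Nat.card (GL (Fin n) F)) =
      ∑ j ∈ Finset.range n, padicValNat 2 (Fintype.card F ^ (j + 1) - 1) := by
  set q := Fintype.card F
  have hq : 1 < q := by omega
  rw [Matrix.card_GL_field, padicValNat_prod]
  · rw [← Finset.sum_range_reflect, Finset.sum_range]
    refine Finset.sum_congr rfl fun i _ => ?_
    have : q ^ n - q ^ (i : ℕ) = q ^ (i : ℕ) * (q ^ (n - 1 - i + 1) - 1) := by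
      rw [Nat.mul_sub, ← pow_add, mul_one]
      congr 2
      omega
    have hne : q ^ (n - 1 - i + 1) - 1 ≠ 0 := by
      have := Nat.one_lt_pow (n := n - 1 - i + 1) (by omega) hq
      omega
    change padicValNat 2 (q ^ n - q ^ (i : ℕ)) = _
    rw [this, padicValNat.mul (by positivity) hne, padicValNat.eq_zero_of_not_dvd
      (n := q ^ (i : ℕ)) (fun h => by have := Nat.prime_two.dvd_of_dvd_pow h; omega), zero_add]
  · intro i _
    have := Nat.pow_lt_pow_right hq i.2
    change q ^ n - q ^ (i : ℕ) ≠ 0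
    omega

theorem padicValNat_card_GL_two_mul (hq4 : Fintype.card F % 4 = 3) (m : ℕ) :
    padicValNat 2 (Nat.card (GL (Fin (2 * m)) F)) =
      (padicValNat 2 (Fintype.card F + 1) + 2) * m + padicValNat 2 m.factorial := by
  rw [padicValNat_card_GL hq4]
  induction m with
  | zero => simp
  | succ m ih =>
    rw [show 2 * (m + 1) = 2 * m + 1 + 1 by ring, Finset.sum_range_succ, Finset.sum_range_succ, ih,
      padicValNat_pow_sub_one_of_odd hq4 (odd_two_mul_add_one m),
      show 2 * m + 1 + 1 = 2 * (m + 1) by ring, padicValNat_pow_sub_one_of_even hq4 (by omega),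
      Nat.factorial_succ, padicValNat.mul (by omega) (Nat.factorial_ne_zero m)]
    ring

theorem card_center_GL {n : ℕ} (hn : n ≠ 0) :
    Nat.card (Subgroup.center (GL (Fin n) F)) = Fintype.card F - 1 := by
  have : NeZero n := ⟨hn⟩
  have hinj : Function.Injective (Matrix.GeneralLinearGroup.scalar (Fin n) : Fˣ →* GL (Fin n) F) := by
    intro a b hab
    have h := congrArg (fun M : GL (Fin n) F => M.val 0 0) hab
    simpa [Matrix.GeneralLinearGroup.scalar, Units.ext_iff] using h
  rw [Matrix.GeneralLinearGroup.center_eq_range_scalar,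
    Nat.card_congr (MonoidHom.ofInjective hinj).toEquiv.symm, Nat.card_units,
    Nat.card_eq_fintype_card]

theorem padicValNat_card_PGL_add_one (hq4 : Fintype.card F % 4 = 3) {n : ℕ} (hn : n ≠ 0) :
    padicValNat 2 (Nat.card (GL (Fin n) F ⧸ Subgroup.center (GL (Fin n) F))) + 1 =
      padicValNat 2 (Nat.card (GL (Fin n) F)) := by
  rw [Subgroup.card_eq_card_quotient_mul_card_subgroup (Subgroup.center (GL (Fin n) F)),
    card_center_GL hn, padicValNat.mul (Nat.card_pos.ne') (by omega)]
  have := padicValNat_pow_sub_one_of_odd hq4 (j := 1) (by decide)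
  rw [pow_one] at this
  rw [this]

end GLOrder

section GaloisOrbits

variable {k K : Type*} [Field k] [Field K] [Algebra k K] [Normal k K]

theorem orbit_algEquiv_eq_rootSet (x : K) :
    MulAction.orbit (K ≃ₐ[k] K) x = (minpoly k x).rootSet K := by
  ext y
  rw [← isConjRoot_iff_mem_minpoly_rootSet (Normal.isIntegral inferInstance x), ]
  constructor
  · rintro ⟨σ, rfl⟩
    exact isConjRoot_iff_exists_algEquiv.mpr ⟨σ⁻¹, by simp [AlgEquiv.smul_def]⟩
  · intro h
    obtain ⟨σ, hσ⟩ := isConjRoot_iff_exists_algEquiv.mp h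
    exact ⟨σ⁻¹, by simp [AlgEquiv.smul_def, ← hσ]⟩

theorem finite_orbit_algEquiv (x : K) : (MulAction.orbit (K ≃ₐ[k] K) x).Finite := by
  rw [orbit_algEquiv_eq_rootSet]
  exact (minpoly k x).rootSet_finite K

theorem ncard_orbit_algEquiv {x : K} (hx : IsSeparable k x) :
    (MulAction.orbit (K ≃ₐ[k] K) x).ncard = Module.finrank k k⟮x⟯ := by
  rw [orbit_algEquiv_eq_rootSet, adjoin.finrank (Normal.isIntegral inferInstance x),
    ← Polynomial.card_rootSet_eq_natDegree hx (Normal.splits inferInstance x),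
    Set.ncard_eq_toFinset_card', Set.toFinset_card]

theorem add_div_eq_iff {δ y z : K} (hy : y ≠ 0) (hz : z ≠ 0) :
    z + δ / z = y + δ / y ↔ z = y ∨ z = δ / y := by
  have h : z + δ / z - (y + δ / y) = (z - y) * (z - δ / y) / z := by field_simp; ring
  rw [← sub_eq_zero, h, div_eq_zero_iff, or_iff_left hz, mul_eq_zero, sub_eq_zero, sub_eq_zero]

/-- `e` and its partner `δ / e` have together at least `2 [k(e + δ / e) : k]` conjugates. -/
theorem two_mul_finrank_le_ncard {e : K} {δ : k} (hδ : δ ≠ 0)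
    (hne : e ≠ algebraMap k K δ / e) (hsep : IsSeparable k (e + algebraMap k K δ / e))
    {S : Set K} (hS : S.Finite) (h₁ : ∀ σ : K ≃ₐ[k] K, σ e ∈ S)
    (h₂ : ∀ σ : K ≃ₐ[k] K, σ (algebraMap k K δ / e) ∈ S) :
    2 * Module.finrank k k⟮e + algebraMap k K δ / e⟯ ≤ S.ncard := by
  classical
  set c := e + algebraMap k K δ / e
  have hf := finite_orbit_algEquiv (k := k) c
  rw [← ncard_orbit_algEquiv hsep, Set.ncard_eq_toFinset_card _ hf, Set.ncard_eq_toFinset_card _ hS,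
    mul_comm]
  set T := hS.toFinset.filter fun y => y + algebraMap k K δ / y ∈ hf.toFinset
  refine le_trans ?_ (Finset.card_le_card (Finset.filter_subset _ _ : T ⊆ hS.toFinset))
  rw [Finset.card_eq_sum_card_fiberwise (s := T) (f := fun y => y + algebraMap k K δ / y)
    (t := hf.toFinset) (fun y hy => (Finset.mem_filter.mp hy).2), ← smul_eq_mul]
  refine Finset.card_nsmul_le_sum _ _ _ fun x hx => ?_
  obtain ⟨σ, rfl⟩ := (Set.Finite.mem_toFinset hf).mp hx
  have hσ : σ • c = σ e + algebraMap k K δ / σ e := by simp [c, AlgEquiv.smul_def]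
  have hδ' : algebraMap k K δ ≠ 0 := by simpa using hδ
  have hσ' : σ • c = σ (algebraMap k K δ / e) + algebraMap k K δ / σ (algebraMap k K δ / e) := by
    rw [hσ, map_div₀, AlgEquiv.commutes, div_div_cancel₀ hδ', add_comm]
  rw [← Finset.card_pair (fun h => hne (σ.injective h) : σ e ≠ σ (algebraMap k K δ / e))]
  refine Finset.card_le_card ?_
  intro y hy
  rw [Finset.mem_insert, Finset.mem_singleton] at hy
  rw [Finset.mem_filter, Finset.mem_filter, Set.Finite.mem_toFinset]
  rcases hy with rfl | rfl
  · exact ⟨⟨h₁ σ, hσ ▸ hx⟩, hσ.symm⟩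
  · exact ⟨⟨h₂ σ, hσ' ▸ hx⟩, hσ'.symm⟩

theorem two_mul_finrank_eq_of_exists {e : K} {δ : k} (he : e ≠ 0) (hδ : δ ≠ 0)
    (hne : e ≠ algebraMap k K δ / e) (hsep : IsSeparable k (e + algebraMap k K δ / e))
    (hsep' : IsSeparable k e) (h : ∃ σ : K ≃ₐ[k] K, σ e = algebraMap k K δ / e) :
    2 * Module.finrank k k⟮e + algebraMap k K δ / e⟯ = Module.finrank k k⟮e⟯ := by
  classical
  obtain ⟨τ, hτ⟩ := h
  have hf := finite_orbit_algEquiv (k := k) e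
  rw [← ncard_orbit_algEquiv hsep']
  refine le_antisymm (two_mul_finrank_le_ncard hδ hne hsep hf (fun σ => ⟨σ, rfl⟩)
    (fun σ => ⟨σ * τ, by simp [AlgEquiv.smul_def, hτ]⟩)) ?_
  set c := e + algebraMap k K δ / e with hc
  have hg := finite_orbit_algEquiv (k := k) c
  rw [← ncard_orbit_algEquiv hsep, Set.ncard_eq_toFinset_card _ hf, Set.ncard_eq_toFinset_card _ hg,
    Finset.card_eq_sum_card_fiberwise (s := hf.toFinset) (f := fun y => y + algebraMap k K δ / y)
    (t := hg.toFinset), mul_comm, ← smul_eq_mul]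
  · refine Finset.sum_le_card_nsmul _ _ _ fun x hx => ?_
    obtain ⟨σ, rfl⟩ := (Set.Finite.mem_toFinset hg).mp hx
    refine le_trans (Finset.card_le_card (t := {σ e, algebraMap k K δ / σ e}) ?_)
      Finset.card_le_two
    intro y hy
    rw [Finset.mem_filter, Set.Finite.mem_toFinset] at hy
    obtain ⟨⟨ρ, rfl⟩, hy⟩ := hy
    have hσ : σ • c = σ e + algebraMap k K δ / σ e := by simp [c, AlgEquiv.smul_def]
    change ρ e + algebraMap k K δ / ρ e = σ • c at hy
    change ρ e ∈ _
    rw [hσ] at hy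
    simpa using (add_div_eq_iff (by simpa using he) (by simpa using he)).mp hy
  · intro y hy
    obtain ⟨σ, rfl⟩ := (Set.Finite.mem_toFinset hf).mp hy
    exact (Set.Finite.mem_toFinset hg).mpr ⟨σ, by simp [c, AlgEquiv.smul_def]⟩

theorem finrank_eq_of_not_exists {e : K} {δ : k} (he : e ≠ 0)
    (hsep : IsSeparable k (e + algebraMap k K δ / e))
    (hsep' : IsSeparable k e) (h : ¬ ∃ σ : K ≃ₐ[k] K, σ e = algebraMap k K δ / e) :
    Module.finrank k k⟮e + algebraMap k K δ / e⟯ = Module.finrank k k⟮e⟯ := by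
  classical
  set c := e + algebraMap k K δ / e with hc
  rw [← ncard_orbit_algEquiv hsep', ← ncard_orbit_algEquiv hsep]
  have him : MulAction.orbit (K ≃ₐ[k] K) c =
      (fun y => y + algebraMap k K δ / y) '' MulAction.orbit (K ≃ₐ[k] K) e := by
    ext y
    simp only [MulAction.orbit, Set.mem_range, Set.mem_image, exists_exists_eq_and]
    simp [c, AlgEquiv.smul_def]
  rw [him, Set.InjOn.ncard_image]
  rintro _ ⟨σ, rfl⟩ _ ⟨ρ, rfl⟩ hy
  rcases (add_div_eq_iff (by simpa [AlgEquiv.smul_def] using he)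
    (by simpa [AlgEquiv.smul_def] using he)).mp hy with h' | h'
  · exact h'
  · refine (h ⟨ρ⁻¹ * σ, ?_⟩).elim
    have : σ e = algebraMap k K δ / ρ e := h'
    rw [AlgEquiv.mul_apply, this, map_div₀, AlgEquiv.commutes]
    simp

/-- An automorphism of `k(e)` moving `e` to `f` is induced by one of the normal field `K`. -/
theorem exists_algEquiv_adjoin_iff {e f : K} {f' : k⟮e⟯} (hf' : (f' : K) = f)
    (hfe : e ∈ k⟮f⟯) :
    (∃ σ : k⟮e⟯ ≃ₐ[k] k⟮e⟯, σ (AdjoinSimple.gen k e) = f') ↔ ∃ σ : K ≃ₐ[k] K, σ e = f := by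
  have hK : ∀ x : K, IsIntegral k x := Normal.isIntegral inferInstance
  constructor
  · rintro ⟨σ, hσ⟩
    refine ⟨σ.liftNormal K, ?_⟩
    have := σ.liftNormal_commutes K (AdjoinSimple.gen k e)
    rw [hσ] at this
    rw [← hf']
    exact this
  · rintro ⟨σ, hσ⟩
    have hmap : k⟮e⟯.map (σ : K →ₐ[k] K) = k⟮e⟯ := by
      rw [IntermediateField.adjoin_map]
      simp only [Set.image_singleton]
      change k⟮σ e⟯ = k⟮e⟯
      rw [hσ]
      refine le_antisymm ?_ ?_
      · rw [adjoin_simple_le_iff, ← hf']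
        exact f'.2
      · rwa [adjoin_simple_le_iff]
    refine ⟨(IntermediateField.intermediateFieldMap σ k⟮e⟯).trans
      (IntermediateField.equivOfEq hmap), ?_⟩
    apply Subtype.ext
    rw [hf', ← hσ]
    rfl

end GaloisOrbits

section RootsOfUnity

variable {k K : Type*} [Field k] [Field K] [Algebra k K]

theorem isSeparable_of_pow_eq_one {N : ℕ} (hN : (N : k) ≠ 0) {x : K} (hx : x ^ N = 1) :
    IsSeparable k x :=
  (Polynomial.separable_X_pow_sub_C (1 : k) hN one_ne_zero).of_dvd
    (minpoly.dvd k x (by simp [hx]))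

theorem isSeparable_add_div {N : ℕ} (hN : (N : k) ≠ 0) {x : K} (hx : x ^ N = 1) (δ : k) :
    IsSeparable k (x + algebraMap k K δ / x) := by
  have h := isSeparable_of_pow_eq_one hN hx
  rw [div_eq_mul_inv]
  exact Field.isSeparable_add h (Field.isSeparable_mul (isSeparable_algebraMap δ)
    (Field.isSeparable_inv h))

theorem pow_add_pow_mem_adjoin {x y : K} (hxy : x * y ∈ k⟮x + y⟯) (i : ℕ) :
    x ^ i + y ^ i ∈ k⟮x + y⟯ := by
  induction i using Nat.strong_induction_on with
  | _ i ih =>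
    match i with
    | 0 => simpa using add_mem (one_mem k⟮x + y⟯) (one_mem _)
    | 1 => simpa using mem_adjoin_simple_self k (x + y)
    | i + 2 =>
      have : x ^ (i + 2) + y ^ (i + 2) =
          (x + y) * (x ^ (i + 1) + y ^ (i + 1)) - x * y * (x ^ i + y ^ i) := by ring
      rw [this]
      exact sub_mem (mul_mem (mem_adjoin_simple_self k _) (ih _ (by omega)))
        (mul_mem hxy (ih _ (by omega)))

theorem adjoin_add_div_le {N : ℕ} [NeZero N] (hN : 2 ∣ N) {e f : K} (he : IsPrimitiveRoot e N)
    (hf : IsPrimitiveRoot f N) {δ : k} (hδ : δ ^ 2 = 1) :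
    k⟮f + algebraMap k K δ / f⟯ ≤ k⟮e + algebraMap k K δ / e⟯ := by
  obtain ⟨i, -, hi, rfl⟩ := he.isPrimitiveRoot_iff.mp hf
  have hodd : Odd i := Nat.coprime_two_right.mp (hi.coprime_dvd_right hN)
  obtain ⟨j, rfl⟩ := hodd
  have hδi : δ ^ (2 * j + 1) = δ := by rw [pow_succ, pow_mul, hδ, one_pow, one_mul]
  have h := pow_add_pow_mem_adjoin (k := k) (x := e) (y := algebraMap k K δ / e) (by
    rw [mul_div_cancel₀ _ (he.ne_zero (NeZero.ne N))]
    exact IntermediateField.algebraMap_mem _ δ) (2 * j + 1)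
  rw [div_pow, ← map_pow, hδi] at h
  rwa [adjoin_simple_le_iff]

theorem finrank_adjoin_add_div_eq {N : ℕ} [NeZero N] (hN : 2 ∣ N) {e f : K}
    (he : IsPrimitiveRoot e N) (hf : IsPrimitiveRoot f N) {δ : k} (hδ : δ ^ 2 = 1) :
    Module.finrank k k⟮f + algebraMap k K δ / f⟯ = Module.finrank k k⟮e + algebraMap k K δ / e⟯ := by
  rw [le_antisymm (adjoin_add_div_le hN he hf hδ) (adjoin_add_div_le hN hf he hδ)]

end RootsOfUnity

section Weights

variable {K V ι G : Type*} [Field K] [AddCommGroup V] [Module K V] [Group G]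

theorem exists_common_eigenvector [IsAlgClosed K] [FiniteDimensional K V]
    (f : ι → Module.End K V) (hf : ∀ i j, Commute (f i) (f j)) (t : Finset ι) (W : Submodule K V)
    (hW : W ≠ ⊥) (hinv : ∀ i, ∀ v ∈ W, f i v ∈ W) :
    ∃ χ : ι → K, ∃ v ∈ W, v ≠ 0 ∧ ∀ i ∈ t, f i v = χ i • v := by
  classical
  induction t using Finset.induction_on generalizing W with
  | empty =>
    obtain ⟨v, hv, hv0⟩ := W.ne_bot_iff.mp hW
    exact ⟨fun _ => 0, v, hv, hv0, by simp⟩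
  | insert a t ha ih =>
    have : Nontrivial W := Submodule.nontrivial_iff_ne_bot.mpr hW
    obtain ⟨μ, hμ⟩ := Module.End.exists_eigenvalue ((f a).restrict (hinv a))
    obtain ⟨w, hw⟩ := hμ.exists_hasEigenvector
    have hw' : f a w = μ • (w : V) := congrArg Subtype.val hw.apply_eq_smul
    obtain ⟨χ, v, hv, hv0, h⟩ := ih (W ⊓ Module.End.eigenspace (f a) μ)
      ((Submodule.ne_bot_iff _).mpr ⟨w, ⟨w.2, Module.End.mem_eigenspace_iff.mpr hw'⟩,
        fun h => hw.2 (Subtype.ext h)⟩) (fun i v hv => ⟨hinv i v hv.1, by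
          have h2 : f a v = μ • v := Module.End.mem_eigenspace_iff.mp hv.2
          refine Module.End.mem_eigenspace_iff.mpr ?_
          have h3 : f a (f i v) = f i (f a v) := LinearMap.congr_fun (hf a i) v
          rw [h3, h2, map_smul]⟩)
    refine ⟨Function.update χ a μ, v, hv.1, hv0, fun i hi => ?_⟩
    rcases Finset.mem_insert.mp hi with rfl | hi
    · rw [Function.update_self]
      exact Module.End.mem_eigenspace_iff.mp hv.2
    · rw [Function.update_of_ne (fun h : i = a => ha (h ▸ hi))]
      exact h i hi

/-- The simultaneous eigencharacters of the operators `T (x i)`. -/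
def weights (T : G →* Module.End K V) (x : ι → G) : Set (ι → K) :=
  {χ | ∃ v, v ≠ 0 ∧ ∀ i, T (x i) v = χ i • v}

theorem card_le_finrank_of_subset_weights [FiniteDimensional K V] {T : G →* Module.End K V}
    {x : ι → G} (hx : ∀ i j, Commute (x i) (x j)) {S : Finset (ι → K)}
    (hS : ↑S ⊆ weights T x) : S.card ≤ Module.finrank K V := by
  have hind := Module.End.independent_iInf_maxGenEigenspace_of_forall_mapsTo
    (fun i => T (x i)) fun i j φ => Module.End.mapsTo_maxGenEigenspace_of_comm
      ((hx j i).map T) φ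
  choose v hv0 hv using fun χ : S => hS χ.2
  have h2 := iSupIndep.linearIndependent _ (hind.comp (f := fun χ : S => (χ : ι → K))
    Subtype.val_injective) (v := v) (fun χ => by
      simp only [Function.comp_apply, Submodule.mem_iInf]
      intro i
      exact (Module.End.genEigenspace (T (x i)) (χ.1 i)).monotone (le_top : (1 : ℕ∞) ≤ ⊤)
        (Module.End.mem_eigenspace_iff.mpr (hv χ i))) hv0
  simpa using h2.fintype_card_le_finrank

theorem exists_mem_weights_neg [IsAlgClosed K] [FiniteDimensional K V] [Finite ι]
    {T : G →* Module.End K V} {x : ι → G} (hx : ∀ i j, Commute (x i) (x j)) {z : G}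
    (hz : ∀ i, Commute z (x i)) (hz2 : T (z ^ 2) = 1) (hz1 : T z ≠ 1) :
    ∃ χ : ι → K, ∃ v, v ≠ 0 ∧ T z v = -v ∧ ∀ i, T (x i) v = χ i • v := by
  have := Fintype.ofFinite ι
  have hz2' : ∀ v, T z (T z v) = v := fun v => by
    rw [← Module.End.mul_apply, ← map_mul, ← sq, hz2, Module.End.one_apply]
  obtain ⟨u, hu⟩ : ∃ u, T z u ≠ u := by
    by_contra! h
    exact hz1 (LinearMap.ext h)
  obtain ⟨χ, v, hv, hv0, h⟩ := exists_common_eigenvector (fun i => T (x i))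
    (fun i j => (hx i j).map T) Finset.univ (Module.End.eigenspace (T z) (-1))
    ((Submodule.ne_bot_iff _).mpr ⟨T z u - u, Module.End.mem_eigenspace_iff.mpr (by
      rw [map_sub, hz2', neg_one_smul, neg_sub]), sub_ne_zero.mpr hu⟩)
    (fun i v hv => Module.End.mem_eigenspace_iff.mpr (by
      have h2 : T z v = (-1 : K) • v := Module.End.mem_eigenspace_iff.mp hv
      have h3 : T z (T (x i) v) = T (x i) (T z v) := LinearMap.congr_fun ((hz i).map T) v
      rw [h3, h2, map_smul]))
  refine ⟨χ, v, hv0, ?_, fun i => h i (Finset.mem_univ i)⟩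
  simpa using (Module.End.mem_eigenspace_iff.mp hv)

theorem apply_pow_of_apply_eq_smul {T : G →* Module.End K V} {g : G} {c : K} {v : V}
    (h : T g v = c • v) (n : ℕ) : T (g ^ n) v = c ^ n • v := by
  induction n with
  | zero => simp
  | succ n ih => rw [pow_succ, map_mul, Module.End.mul_apply, h, map_smul, ih, smul_smul, ← pow_succ']

theorem mem_weights_of_conj {T : G →* Module.End K V} {x : ι → G} {χ : ι → K}
    (hχ : χ ∈ weights T x) (g : G) {π : ι → ι} {u : ι → ℕ}
    (hg : ∀ i, g⁻¹ * x i * g = x (π i) ^ u i) : (fun i => χ (π i) ^ u i) ∈ weights T x := by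
  obtain ⟨v, hv0, hv⟩ := hχ
  refine ⟨T g v, fun h => hv0 ?_, fun i => ?_⟩
  · have := congrArg (T g⁻¹) h
    rwa [← Module.End.mul_apply, ← map_mul, inv_mul_cancel, map_one, map_zero] at this
  · have : x i * g = g * x (π i) ^ u i := by rw [← hg i]; group
    rw [← Module.End.mul_apply, ← map_mul, this, map_mul, Module.End.mul_apply,
      apply_pow_of_apply_eq_smul (hv (π i)), map_smul]

end Weights

section Descent

variable {k K ι G : Type*} [Field k] [Field K] [Algebra k K] [Group G] {d : ℕ}

/-- Scalar extension of a matrix representation. -/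
noncomputable def scalarExtension (K : Type*) [Field K] [Algebra k K] (θ : G →* GL (Fin d) k) :
    G →* Module.End K (Fin d → K) :=
  (Matrix.toLinAlgEquiv' : Matrix (Fin d) (Fin d) K ≃ₐ[K] _).toAlgHom.toMonoidHom.comp
    ((algebraMap k K).mapMatrix.toMonoidHom.comp ((Units.coeHom _).comp θ))

theorem scalarExtension_apply (θ : G →* GL (Fin d) k) (g : G) (v : Fin d → K) :
    scalarExtension K θ g v = ((θ g).val.map (algebraMap k K)).mulVec v := rfl

theorem scalarExtension_eq_one_iff (θ : G →* GL (Fin d) k) (g : G) :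
    scalarExtension K θ g = 1 ↔ θ g = 1 := by
  constructor
  · intro h
    apply Units.ext
    have h1 : (algebraMap k K).mapMatrix (θ g).val = 1 :=
      (Matrix.toLinAlgEquiv' : Matrix (Fin d) (Fin d) K ≃ₐ[K] _).injective
        (h.trans (map_one _).symm)
    exact Matrix.map_injective (algebraMap k K).injective (h1.trans
      (map_one (algebraMap k K).mapMatrix).symm)
  · intro h
    simp [scalarExtension, h]

theorem mem_weights_of_algEquiv {θ : G →* GL (Fin d) k} {x : ι → G} {χ : ι → K}
    (hχ : χ ∈ weights (scalarExtension K θ) x) (σ : K ≃ₐ[k] K) :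
    (fun i => σ (χ i)) ∈ weights (scalarExtension K θ) x := by
  obtain ⟨v, hv0, hv⟩ := hχ
  refine ⟨σ ∘ v, fun h => hv0 ?_, fun i => ?_⟩
  · funext j
    simpa using congrFun h j
  · funext j
    have := congrArg σ (congrFun (hv i) j)
    simpa [scalarExtension_apply, Matrix.mulVec, dotProduct] using this

end Descent

section Combinatorics

theorem eq_one_of_mul_mem_of_odd {O : Type*} [Group O] {v : ℕ} {w : O}
    (hw : w ^ 2 ^ v = 1) {U : Finset O} (hU : Odd U.card) (h : ∀ x, w * x ∈ U ↔ x ∈ U) :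
    w = 1 := by
  classical
  replace h : ∀ x, Equiv.mulLeft w x ∈ U ↔ x ∈ U := h
  have hσ : ((Equiv.mulLeft w).subtypePerm h : Equiv.Perm {x // x ∈ U}) ^ 2 ^ v = 1 := by
    rw [Equiv.Perm.subtypePerm_pow]
    ext x
    simp [hw]
  have : Fact (Nat.Prime 2) := ⟨Nat.prime_two⟩
  obtain ⟨x, hx⟩ := Equiv.Perm.exists_fixed_point_of_prime (p := 2) (n := v)
    (by rw [Fintype.card_coe]; exact hU.not_two_dvd_nat) hσ
  exact mul_eq_right.mp (congrArg Subtype.val hx)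

theorem Finset.card_inter_eq_sum {α : Type*} [DecidableEq α] (A X : Finset α) :
    (A ∩ X).card = ∑ a ∈ A, if a ∈ X then 1 else 0 := by
  rw [← Finset.filter_mem_eq_inter, Finset.card_filter]

theorem card_sub_one_le_of_separating {J : Type*} [Fintype J] [DecidableEq J]
    (𝒜 : Finset (Finset J))
    (h : ∀ T : Finset J, T ≠ ∅ → T ≠ Finset.univ → ∃ A ∈ 𝒜, Odd (T ∩ A).card) :
    Fintype.card J - 1 ≤ 𝒜.card := by
  classical
  rcases isEmpty_or_nonempty J with hJ | ⟨⟨j₀⟩⟩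
  · simp
  have hinj : Set.InjOn (fun T : Finset J => 𝒜.filter fun A => Odd (T ∩ A).card)
      ↑(Finset.univ.erase j₀).powerset := by
    intro T hT T' hT' hTT
    simp only [Finset.coe_powerset, Set.mem_preimage, Set.mem_powerset_iff, Finset.coe_subset] at hT hT'
    by_contra hne
    obtain ⟨A, hA, hodd⟩ := h (symmDiff T T') (fun h0 => hne (by simpa using h0)) (fun hu => by
      have : j₀ ∈ symmDiff T T' := hu ▸ Finset.mem_univ _
      rcases Finset.mem_symmDiff.mp this with h' | h'
      · exact Finset.notMem_erase j₀ _ (hT h'.1)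
      · exact Finset.notMem_erase j₀ _ (hT' h'.1))
    have h1 : Odd (T ∩ A).card ↔ Odd (T' ∩ A).card := by
      have := Finset.ext_iff.mp hTT A
      simpa [hA] using this
    have h2 : (symmDiff T T' ∩ A).card + 2 * (T ∩ T' ∩ A).card = (T ∩ A).card + (T' ∩ A).card := by
      simp only [Finset.inter_comm _ A, Finset.card_inter_eq_sum] 
      rw [Finset.mul_sum, ← Finset.sum_add_distrib, ← Finset.sum_add_distrib]
      refine Finset.sum_congr rfl fun a _ => ?_
      by_cases h₁ : a ∈ T <;> by_cases h₂ : a ∈ T' <;> simp [Finset.mem_symmDiff, h₁, h₂]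
    rw [Nat.odd_iff] at h1 hodd
    rw [Nat.odd_iff] at h1
    omega
  have := Finset.card_le_card_of_injOn (t := 𝒜.powerset) _
    (fun T _ => Finset.mem_powerset.mpr (Finset.filter_subset _ _)) hinj
  rw [Finset.card_powerset, Finset.card_powerset, Finset.card_erase_of_mem (Finset.mem_univ _),
    Finset.card_univ] at this
  exact (Nat.pow_le_pow_iff_right (by norm_num)).mp this

end Combinatorics

section WreathWeights

open Semidihedral

variable {s : ℕ} {hs : 3 ≤ s} {R ι : Type*} [Group R] [MulAction R ι] [DecidableEq ι]

namespace PermWreath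

/-- The rotation placed at the coordinate `i`. -/
def rotAt (s : ℕ) (hs : 3 ≤ s) (R : Type*) {ι : Type*} [Group R] [MulAction R ι] [DecidableEq ι]
    (i : ι) : PermWreath (Semidihedral s hs) R ι :=
  SemidirectProduct.inl (Pi.mulSingle i (rot s hs))

theorem commute_rotAt (i j : ι) : Commute (rotAt s hs R i) (rotAt s hs R j) := by
  refine Commute.map (f := SemidirectProduct.inl) ?_
  by_cases h : i = j
  · rw [h]
  · exact Pi.mulSingle_commute h _ _

theorem flip_conj_rotAt (f : ι → Bool) (i : ι) :
    (SemidirectProduct.inl (fun i => if f i then flip s hs else 1) :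
        PermWreath (Semidihedral s hs) R ι)⁻¹ * rotAt s hs R i *
      SemidirectProduct.inl (fun i => if f i then flip s hs else 1) =
    rotAt s hs R i ^ (if f i then twistExp s else 1) := by
  rw [rotAt, ← map_inv, ← map_mul, ← map_mul, ← map_pow]
  congr 1
  ext j : 1
  by_cases hj : j = i
  · subst hj
    by_cases hf : f j
    · simp [hf, flip_rot_flip]
    · simp [hf]
  · by_cases hf : f j <;> simp [hf, Pi.mulSingle_eq_of_ne hj]

theorem inr_conj_rotAt (r : R) (i : ι) :
    (SemidirectProduct.inr r : PermWreath (Semidihedral s hs) R ι)⁻¹ * rotAt s hs R i *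
      SemidirectProduct.inr r = rotAt s hs R (r⁻¹ • i) := by
  refine SemidirectProduct.ext ?_ (by simp [rotAt])
  funext j
  rw [mul_left_apply, mul_left_apply]
  simp only [SemidirectProduct.left_inr, rotAt, SemidirectProduct.left_inl, Pi.one_apply,
    SemidirectProduct.right_inr, ← map_inv, inv_inv, one_mul, mul_one]
  simp only [Pi.mulSingle_apply, smul_eq_iff_eq_inv_smul]

variable {K V : Type*} [Field K] [AddCommGroup V] [Module K V]

theorem apply_rotAt_prod {T : PermWreath (Semidihedral s hs) R ι →* Module.End K V} {χ : ι → K}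
    {v : V} (hv : ∀ i, T (rotAt s hs R i) v = χ i • v) (n : ℕ) (t : Finset ι) :
    T (SemidirectProduct.inl fun i => if i ∈ t then rot s hs ^ n else 1) v =
      (∏ i ∈ t, χ i ^ n) • v := by
  induction t using Finset.induction_on with
  | empty =>
    have : (fun i : ι => if i ∈ (∅ : Finset ι) then rot s hs ^ n else 1) = 1 := by
      funext i; simp
    rw [this, map_one, map_one]
    simp
  | insert a t ha ih =>
    have : (fun i : ι => if i ∈ insert a t then rot s hs ^ n else 1) =
        Pi.mulSingle a (rot s hs) ^ n * fun i => if i ∈ t then rot s hs ^ n else 1 := by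
      funext i
      by_cases hi : i = a
      · subst hi; simp [ha]
      · simp [hi]
    rw [this, map_mul, map_mul, Module.End.mul_apply, ih, map_smul, map_pow,
      ← rotAt, apply_pow_of_apply_eq_smul (hv a), smul_smul, Finset.prod_insert ha, mul_comm]

theorem weights_move {k : Type*} [Field k] [Algebra k K] {d : ℕ}
    {θ : PermWreath (Semidihedral s hs) R ι →* GL (Fin d) k} {χ : ι → K}
    (hχ : χ ∈ weights (scalarExtension K θ) (rotAt s hs R)) (σ : K ≃ₐ[k] K) (f : ι → Bool) (r : R) :
    (fun i => σ (χ (r⁻¹ • i)) ^ (if f (r⁻¹ • i) then twistExp s else 1)) ∈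
      weights (scalarExtension K θ) (rotAt s hs R) := by
  have h₁ := mem_weights_of_algEquiv hχ σ
  have h₂ := mem_weights_of_conj h₁ (SemidirectProduct.inl fun i => if f i then flip s hs else 1)
    (π := id) (flip_conj_rotAt f)
  have h₃ := mem_weights_of_conj h₂ (SemidirectProduct.inr r) (π := fun i => r⁻¹ • i)
    (u := fun _ => 1) (fun i => by rw [pow_one]; exact inr_conj_rotAt r i)
  simpa using h₃

end PermWreath
end WreathWeights

section PowerIdentities

variable {K : Type*} [Field K] {s : ℕ}

theorem isPrimitiveRoot_two_pow_of_pow_eq_neg_one (hs : 3 ≤ s) (h2 : (-1 : K) ≠ 1) {x : K}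
    (hx : x ^ 2 ^ (s - 1) = -1) : IsPrimitiveRoot x (2 ^ s) := by
  have : Fact (Nat.Prime 2) := ⟨Nat.prime_two⟩
  have h := orderOf_eq_prime_pow (p := 2) (n := s - 1) (x := x) (by rw [hx]; exact h2) (by
    rw [pow_succ, pow_mul, hx, neg_one_sq])
  rw [Nat.sub_add_cancel (by omega)] at h
  exact h ▸ IsPrimitiveRoot.orderOf x

theorem IsPrimitiveRoot.pow_two_pow_pred (hs : 3 ≤ s) {x : K} (hx : IsPrimitiveRoot x (2 ^ s)) :
    x ^ 2 ^ (s - 1) = -1 := by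
  have h : (x ^ 2 ^ (s - 1)) ^ 2 = 1 := by rw [← pow_mul, mul_comm, ← two_pow_eq s hs, hx.pow_eq_one]
  rcases sq_eq_one_iff.mp h with h | h
  · exact absurd h (hx.pow_ne_one_of_pos_of_lt (by positivity)
      (Nat.pow_lt_pow_right (by norm_num) (by omega)))
  · exact h

theorem pow_twistExp_eq_div (x : K) (hx0 : x ≠ 0) : x ^ twistExp s = x ^ 2 ^ (s - 1) / x := by
  rw [eq_div_iff hx0, ← pow_succ, twistExp_add_one]

theorem pow_twistExp_pow (hs : 3 ≤ s) {x : K} (hx : x ^ 2 ^ s = 1) :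
    (x ^ twistExp s) ^ 2 ^ (s - 1) = x ^ 2 ^ (s - 1) := by
  have hx0 : x ≠ 0 := by rintro rfl; simp at hx
  have h : (x ^ 2 ^ (s - 1)) ^ 2 = 1 := by rw [← pow_mul, mul_comm, ← two_pow_eq s hs, hx]
  have hM : 2 ^ (s - 1) = 2 * 2 ^ (s - 2) := by
    rw [← pow_succ']; congr 1; omega
  rw [pow_twistExp_eq_div x hx0, div_pow, hM, pow_mul, ← hM, h, one_pow, one_div]
  exact inv_eq_of_mul_eq_one_left (by rw [← sq, h])

theorem IsPrimitiveRoot.pow_twistExp_ne (hs : 3 ≤ s) {x : K} (hx : IsPrimitiveRoot x (2 ^ s)) :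
    x ≠ x ^ twistExp s := by
  intro h
  have hlt : (4 : ℕ) < 2 ^ s := by
    calc 4 < 2 ^ 3 := by norm_num
      _ ≤ 2 ^ s := Nat.pow_le_pow_right (by norm_num) hs
  have h4 : 2 ^ s = 2 * 2 ^ (s - 1) := two_pow_eq s hs
  have := hx.pow_inj (i := 1) (j := twistExp s) (by omega)
    (by rw [twistExp]; omega) (by rwa [pow_one])
  rw [twistExp] at this
  omega

end PowerIdentities

section LowerBound

open Semidihedral PermWreath

/-- Blockwise left translations of `J × O`. -/
instance blockTranslation (J O : Type*) [Group O] : MulAction (J → O) (J × O) where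
  smul q a := (a.1, q a.1 * a.2)
  one_smul a := Prod.ext rfl (one_mul a.2)
  mul_smul q r a := Prod.ext rfl (mul_assoc (q a.1) (r a.1) a.2)

theorem blockTranslation_smul {J O : Type*} [Group O] (q : J → O) (j : J) (o : O) :
    q • (j, o) = (j, q j * o) := rfl

instance (J O : Type*) [Group O] : FaithfulSMul (J → O) (J × O) where
  eq_of_smul_eq_smul {q r} h := funext fun j => by
    simpa [blockTranslation_smul] using h (j, 1)

variable {s : ℕ} {hs : 3 ≤ s} {J O : Type*} [Fintype J] [DecidableEq J] [Group O] [Fintype O]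
  [DecidableEq O] {k K : Type*} [Field k] [Field K] [Algebra k K]

/-- The positions in the block `j` at which the character `χ` is a primitive root. -/
noncomputable def oddPositions (s : ℕ) (χ : J × O → K) (j : J) : Finset O :=
  open Classical in Finset.univ.filter fun o => χ (j, o) ^ 2 ^ (s - 1) = -1

omit [Fintype J] [DecidableEq J] [Group O] [DecidableEq O] in
theorem mem_oddPositions {χ : J × O → K} {j : J} {o : O} :
    o ∈ oddPositions s χ j ↔ χ (j, o) ^ 2 ^ (s - 1) = -1 := by
  simp [oddPositions]

/-- The blocks with an odd number of odd positions. -/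
noncomputable def oddBlocks (s : ℕ) (χ : J × O → K) : Finset J :=
  open Classical in Finset.univ.filter fun j => Odd (oddPositions s χ j).card

omit [DecidableEq J] [Group O] [DecidableEq O] in
theorem mem_oddBlocks {χ : J × O → K} {j : J} :
    j ∈ oddBlocks s χ ↔ Odd (oddPositions s χ j).card := by
  simp [oddBlocks]

section Move

/-- The character obtained from `χ` by an automorphism, coordinate flips and translations. -/
def movedCharacter (s : ℕ) (χ : J × O → K) (σ : K ≃ₐ[k] K) (f : J × O → Bool) (q : J → O) :
    J × O → K :=
  fun i => σ (χ (q⁻¹ • i)) ^ (if f (q⁻¹ • i) then twistExp s else 1)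

omit [Fintype J] [DecidableEq J] [Fintype O] [DecidableEq O] in
theorem movedCharacter_pow (hs : 3 ≤ s) {χ : J × O → K} (hχ : ∀ i, χ i ^ 2 ^ s = 1)
    (σ : K ≃ₐ[k] K) (f : J × O → Bool) (q : J → O) (i : J × O) :
    movedCharacter s χ σ f q i ^ 2 ^ (s - 1) = σ (χ (q⁻¹ • i) ^ 2 ^ (s - 1)) := by
  rw [movedCharacter]
  by_cases hf : f (q⁻¹ • i)
  · rw [if_pos hf, pow_twistExp_pow hs (by rw [← map_pow, hχ, map_one]), map_pow]
  · rw [if_neg hf, pow_one, map_pow]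

omit [Fintype J] [DecidableEq J] [DecidableEq O] in
theorem mem_oddPositions_movedCharacter (hs : 3 ≤ s) {χ : J × O → K}
    (hχ : ∀ i, χ i ^ 2 ^ s = 1) (σ : K ≃ₐ[k] K) (f : J × O → Bool) (q : J → O) (j : J) (o : O) :
    o ∈ oddPositions s (movedCharacter s χ σ f q) j ↔ (q j)⁻¹ * o ∈ oddPositions s χ j := by
  rw [mem_oddPositions, mem_oddPositions, movedCharacter_pow hs hχ, blockTranslation_smul,
    Pi.inv_apply]
  constructor
  · intro h
    exact σ.injective (by rw [h, map_neg, map_one])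
  · intro h
    rw [h, map_neg, map_one]

omit [DecidableEq J] [DecidableEq O] in
theorem oddBlocks_movedCharacter (hs : 3 ≤ s) {χ : J × O → K}
    (hχ : ∀ i, χ i ^ 2 ^ s = 1) (σ : K ≃ₐ[k] K) (f : J × O → Bool) (q : J → O) :
    oddBlocks s (movedCharacter s χ σ f q) = oddBlocks s χ := by
  ext j
  rw [mem_oddBlocks, mem_oddBlocks]
  have : oddPositions s (movedCharacter s χ σ f q) j =
      (oddPositions s χ j).map (Equiv.mulLeft (q j)).toEmbedding := by
    ext o
    rw [mem_oddPositions_movedCharacter hs hχ, Finset.mem_map_equiv]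
    rfl
  rw [this, Finset.card_map]

end Move

variable [Normal k K]

/-- A set of characters stable under the moves contains many characters with the odd blocks of a
given one. -/
theorem card_moved_characters_ge (hs : 3 ≤ s) (h2 : (-1 : k) ≠ 1) {ε : K}
    (hε : IsPrimitiveRoot ε (2 ^ s)) {v : ℕ} (hO : ∀ w : O, w ^ 2 ^ v = 1) {Λ : Set (J × O → K)}
    (hΛ : Λ.Finite) (hmove : ∀ χ ∈ Λ, ∀ (σ : K ≃ₐ[k] K) f q, movedCharacter s χ σ f q ∈ Λ)
    {χ : J × O → K} (hχΛ : χ ∈ Λ) (hχ : ∀ i, χ i ^ 2 ^ s = 1) {j j' : J} (hjj : j ≠ j')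
    (hj : j ∈ oddBlocks s χ) (hj' : j' ∈ oddBlocks s χ) :
    2 * Module.finrank k k⟮ε + algebraMap k K (-1) / ε⟯ * (2 * (Fintype.card O * Fintype.card O)) ≤
      {ψ ∈ Λ | oddBlocks s ψ = oddBlocks s χ}.ncard := by
  have h2K : (-1 : K) ≠ 1 := fun h => h2 ((algebraMap k K).injective (by simpa using h))
  rw [mem_oddBlocks] at hj hj'
  obtain ⟨o, ho⟩ := Finset.card_pos.mp hj.pos
  obtain ⟨o', ho'⟩ := Finset.card_pos.mp hj'.pos
  have he := isPrimitiveRoot_two_pow_of_pow_eq_neg_one hs h2K (mem_oddPositions.mp ho)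
  have he' := isPrimitiveRoot_two_pow_of_pow_eq_neg_one hs h2K (mem_oddPositions.mp ho')
  set e := χ (j, o)
  set e' := χ (j', o')
  have hτ : e ^ twistExp s = algebraMap k K (-1) / e := by
    rw [pow_twistExp_eq_div _ (he.ne_zero (by positivity)), he.pow_two_pow_pred hs]
    simp
  set 𝒟 : Set K := {y | ∃ (σ : K ≃ₐ[k] K) (b : Bool), σ e ^ (if b then twistExp s else 1) = y}
  have h𝒟 : 𝒟.Finite := by
    refine ((finite_orbit_algEquiv (k := k) e).union
      (finite_orbit_algEquiv (k := k) (e ^ twistExp s))).subset ?_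
    rintro _ ⟨σ, b, rfl⟩
    cases b
    · exact Or.inl ⟨σ, by simp [AlgEquiv.smul_def]⟩
    · exact Or.inr ⟨σ, by simp [AlgEquiv.smul_def]⟩
  have hcard : 2 * Module.finrank k k⟮ε + algebraMap k K (-1) / ε⟯ ≤ 𝒟.ncard := by
    have : NeZero (2 ^ s) := ⟨by positivity⟩
    rw [finrank_adjoin_add_div_eq (dvd_pow_self 2 (by omega)) he hε (by ring)]
    refine two_mul_finrank_le_ncard (by simp) (by rw [← hτ]; exact he.pow_twistExp_ne hs)
      (isSeparable_add_div (N := 2 ^ s) ?_ he.pow_eq_one _) h𝒟 (fun σ => ⟨σ, false, by simp⟩)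
      (fun σ => ⟨σ, true, by rw [← hτ]; simp⟩)
    rw [Nat.cast_pow]
    exact pow_ne_zero _ fun h => h2 (by linear_combination -h)
  choose σ b hσb using fun y : 𝒟 => y.2
  let fl : 𝒟 → Bool → J × O → Bool := fun y c i =>
    if i = (j, o) then b y else if i = (j', o') then c else false
  let tr : O → O → J → O := fun w w' i => if i = j then w else if i = j' then w' else 1
  let F : 𝒟 × Bool × O × O → {ψ ∈ Λ | oddBlocks s ψ = oddBlocks s χ} := fun a =>
    ⟨movedCharacter s χ (σ a.1) (fl a.1 a.2.1) (tr a.2.2.1 a.2.2.2), hmove χ hχΛ _ _ _,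
      oddBlocks_movedCharacter hs hχ _ _ _⟩
  have hF : Function.Injective F := by
    rintro ⟨y₁, c₁, w₁, w₁'⟩ ⟨y₂, c₂, w₂, w₂'⟩ h
    replace h : movedCharacter s χ (σ y₁) (fl y₁ c₁) (tr w₁ w₁') =
      movedCharacter s χ (σ y₂) (fl y₂ c₂) (tr w₂ w₂') := congrArg Subtype.val h
    have key : ∀ i, Odd (oddPositions s χ i).card → tr w₁ w₁' i = tr w₂ w₂' i := by
      intro i hi
      refine (inv_mul_eq_one.mp (eq_one_of_mul_mem_of_odd
        (w := (tr w₂ w₂' i)⁻¹ * tr w₁ w₁' i) (hO _) hi fun x => ?_)).symm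
      have h3 := mem_oddPositions_movedCharacter hs hχ (σ y₁) (fl y₁ c₁) (tr w₁ w₁') i
        (tr w₁ w₁' i * x)
      rw [h, mem_oddPositions_movedCharacter hs hχ] at h3
      simpa [mul_assoc] using h3
    have hw : w₁ = w₂ := by simpa [tr] using key j hj
    have hw' : w₁' = w₂' := by simpa [tr, hjj.symm] using key j' hj'
    subst hw hw'
    have hinv : ∀ i x, (tr w₁ w₁')⁻¹ • ((i, tr w₁ w₁' i * x) : J × O) = (i, x) := fun i x => by
      simp [blockTranslation_smul]
    have hy : y₁ = y₂ := by
      have h3 := congrFun h (j, tr w₁ w₁' j * o)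
      simp only [movedCharacter, hinv] at h3
      apply Subtype.ext
      rw [← hσb y₁, ← hσb y₂]
      simpa [fl] using h3
    subst hy
    have hc : c₁ = c₂ := by
      have h3 := congrFun h (j', tr w₁ w₁' j' * o')
      simp only [movedCharacter, hinv] at h3
      have hne : ((j', o') : J × O) ≠ (j, o) := fun h => hjj (congrArg Prod.fst h).symm
      simp only [fl, if_neg hne, if_true, ← map_pow] at h3
      have h4 := (σ y₁).injective h3
      have h5 : χ (j', o') ≠ χ (j', o') ^ twistExp s := he'.pow_twistExp_ne hs
      rcases c₁ with _ | _ <;> rcases c₂ with _ | _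
      · rfl
      · exact absurd (by simpa using h4) h5
      · exact absurd (by simpa using h4.symm) h5
      · rfl
    rw [hc]
  have hfin : {ψ ∈ Λ | oddBlocks s ψ = oddBlocks s χ}.Finite := hΛ.subset (Set.sep_subset _ _)
  have := hfin.to_subtype
  have hle := Nat.card_le_card_of_injective F hF
  rw [Nat.card_prod, Nat.card_prod, Nat.card_prod, Nat.card_coe_set_eq, Nat.card_coe_set_eq,
    Nat.card_eq_fintype_card, Nat.card_eq_fintype_card, Fintype.card_bool] at hle
  exact (Nat.mul_le_mul_right _ hcard).trans hle

end LowerBound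

section LowerBound

open Semidihedral PermWreath

variable {s : ℕ} {hs : 3 ≤ s} {J O : Type*} [Fintype J] [DecidableEq J] [Group O] [Fintype O]
  [DecidableEq O] {k K : Type*} [Field k] [Field K] [Algebra k K]

theorem Finset.prod_ite_neg_one {α : Type*} (A : Finset α) (p : α → Prop) [DecidablePred p] :
    ∏ a ∈ A, (if p a then (-1 : K) else 1) = (-1) ^ (A.filter p).card := by
  rw [Finset.prod_ite, Finset.prod_const, Finset.prod_const_one, mul_one]

omit [Group O] [DecidableEq O] in
theorem prod_pow_eq_neg_one_pow (hs : 3 ≤ s) {χ : J × O → K} (hχ : ∀ i, χ i ^ 2 ^ s = 1)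
    (T : Finset J) : ∏ i ∈ T ×ˢ (Finset.univ : Finset O), χ i ^ 2 ^ (s - 1) =
      (-1) ^ (T ∩ oddBlocks s χ).card := by
  classical
  rw [Finset.prod_product, ← Finset.filter_mem_eq_inter, ← Finset.prod_ite_neg_one]
  refine Finset.prod_congr rfl fun j _ => ?_
  have h : ∀ o, χ (j, o) ^ 2 ^ (s - 1) = if o ∈ oddPositions s χ j then -1 else 1 := by
    intro o
    by_cases ho : χ (j, o) ^ 2 ^ (s - 1) = -1
    · rw [if_pos (mem_oddPositions.mpr ho), ho]
    · rw [if_neg (fun h => ho (mem_oddPositions.mp h))]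
      refine (sq_eq_one_iff.mp ?_).resolve_right ho
      rw [← pow_mul, mul_comm, ← two_pow_eq s hs, hχ]
  rw [Finset.prod_congr rfl fun o _ => h o, Finset.prod_ite_neg_one, Finset.filter_univ_mem]
  by_cases hj : j ∈ oddBlocks s χ
  · rw [if_pos hj, (mem_oddBlocks.mp hj).neg_one_pow]
  · rw [if_neg hj, (Nat.not_odd_iff_even.mp fun h => hj (mem_oddBlocks.mpr h)).neg_one_pow]

theorem le_dim_of_kernel_eq [IsAlgClosed K] [Normal k K] (h2 : (-1 : k) ≠ 1) {ε : K}
    (hε : IsPrimitiveRoot ε (2 ^ s)) {v : ℕ} (hO : ∀ w : O, w ^ 2 ^ v = 1) {d : ℕ}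
    (θ : PermWreath (Semidihedral s hs) (J → O) (J × O) →* GL (Fin d) k)
    (hθ : ∀ g, θ g = 1 ↔ g = 1 ∨ g = const (J → O) (J × O) (negOne s hs)) :
    (Fintype.card J - 1) * (2 * Module.finrank k k⟮ε + algebraMap k K (-1) / ε⟯ *
      (2 * (Fintype.card O * Fintype.card O))) ≤ d := by
  classical
  have h2K : (-1 : K) ≠ 1 := fun h => h2 ((algebraMap k K).injective (by simpa using h))
  set T := scalarExtension K θ
  set x : J × O → _ := rotAt s hs (J → O)
  have hcomm : ∀ i j, Commute (x i) (x j) := commute_rotAt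
  have hbound : ∀ S : Finset (J × O → K), ↑S ⊆ weights T x → S.card ≤ d := fun S hS => by
    simpa using card_le_finrank_of_subset_weights hcomm hS
  have hfin : (weights T x).Finite := by
    by_contra hinf
    obtain ⟨S, hS, hcard⟩ := Set.Infinite.exists_subset_card_eq hinf (d + 1)
    have := hbound S hS
    omega
  have hker : ∀ g, T g = 1 ↔ g = 1 ∨ g = const (J → O) (J × O) (negOne s hs) := fun g =>
    (scalarExtension_eq_one_iff θ g).trans (hθ g)
  let z : Finset J → PermWreath (Semidihedral s hs) (J → O) (J × O) := fun A =>
    SemidirectProduct.inl fun i =>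
      if i ∈ A ×ˢ (Finset.univ : Finset O) then rot s hs ^ 2 ^ (s - 1) else 1
  have hz1 : z Finset.univ = const (J → O) (J × O) (negOne s hs) := by
    simp [z, const, negOne]
  have hscal : ∀ {a b : K} {v : Fin d → K}, v ≠ 0 → a • v = b • v → a = b := fun hv h =>
    smul_left_injective K hv h
  have hpow : ∀ χ ∈ weights T x, ∀ i, χ i ^ 2 ^ s = 1 := by
    rintro χ ⟨v, hv, h⟩ i
    have h1 := apply_pow_of_apply_eq_smul (h i) (2 ^ s)
    have h3 : x i ^ 2 ^ s = 1 := by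
      rw [show x i = SemidirectProduct.inl _ from rfl, ← map_pow, ← Pi.mulSingle_pow,
        rot_pow_two_pow, Pi.mulSingle_one, map_one]
    rw [h3, map_one, Module.End.one_apply] at h1
    exact hscal hv (by rw [← h1, one_smul])
  have heven : ∀ χ ∈ weights T x, Even (oddBlocks s χ).card := by
    intro χ hχ
    obtain ⟨v, hv, h⟩ := id hχ
    have h1 := apply_rotAt_prod (T := T) h (2 ^ (s - 1)) (Finset.univ ×ˢ Finset.univ)
    rw [prod_pow_eq_neg_one_pow hs (hpow χ hχ), Finset.univ_inter] at h1
    have h3 : T (z Finset.univ) v = v := by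
      rw [(hker _).mpr (Or.inr hz1), Module.End.one_apply]
    have h4 : (1 : K) = (-1) ^ (oddBlocks s χ).card := hscal hv (by rw [one_smul, ← h1]; exact h3.symm)
    by_contra hodd
    rw [(Nat.not_even_iff_odd.mp hodd).neg_one_pow] at h4
    exact h2K h4.symm
  let 𝒜 : Finset (Finset J) := (hfin.toFinset.image (oddBlocks s)).filter Finset.Nonempty
  have hsep : Fintype.card J - 1 ≤ 𝒜.card := by
    refine card_sub_one_le_of_separating 𝒜 fun A hA0 hA1 => ?_
    obtain ⟨a, ha⟩ := Finset.nonempty_iff_ne_empty.mpr hA0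
    obtain ⟨a', ha'⟩ : ∃ a', a' ∉ A := by
      by_contra! h
      exact hA1 (Finset.eq_univ_of_forall h)
    have hzA : T (z A) ≠ 1 := by
      rw [Ne, hker]
      rintro (h | h)
      · have := congrFun (congrArg SemidirectProduct.left h) (a, 1)
        simp [z, ha] at this
        exact negOne_ne_one this
      · have := congrFun (congrArg SemidirectProduct.left h) (a', 1)
        simp [z, ha', const] at this
        exact negOne_ne_one this.symm
    have hzA2 : z A ^ 2 = 1 := by
      rw [← map_pow]
      refine (congrArg SemidirectProduct.inl (funext fun i => ?_)).trans
        (map_one SemidirectProduct.inl)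
      by_cases hi : i ∈ A ×ˢ (Finset.univ : Finset O)
      · rw [Pi.pow_apply, if_pos hi]
        exact negOne_sq
      · rw [Pi.pow_apply, if_neg hi]
        simp
    have hzx : ∀ i, Commute (z A) (x i) := fun i => by
      refine Commute.map (f := SemidirectProduct.inl) ?_
      refine Pi.commute_iff.mpr fun j => ?_
      by_cases hj : j = i
      · subst hj
        rw [Pi.mulSingle_eq_same]
        split_ifs
        · exact (Commute.refl _).pow_left _
        · exact Commute.one_left _
      · rw [Pi.mulSingle_eq_of_ne hj]
        exact Commute.one_right _
    obtain ⟨χ, v, hv, hneg, h⟩ := exists_mem_weights_neg (T := T) hcomm hzx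
      (by rw [hzA2, map_one]) hzA
    have hχ : χ ∈ weights T x := ⟨v, hv, h⟩
    have h1 := apply_rotAt_prod (T := T) h (2 ^ (s - 1)) (A ×ˢ Finset.univ)
    rw [prod_pow_eq_neg_one_pow hs (hpow χ hχ)] at h1
    have h4 : (-1 : K) = (-1) ^ (A ∩ oddBlocks s χ).card :=
      hscal hv (by rw [← h1, neg_one_smul]; exact hneg.symm)
    have hodd : Odd (A ∩ oddBlocks s χ).card := by
      by_contra he
      rw [(Nat.not_odd_iff_even.mp he).neg_one_pow] at h4
      exact h2K h4
    refine ⟨oddBlocks s χ, ?_, hodd⟩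
    rw [Finset.mem_filter, Finset.mem_image]
    exact ⟨⟨χ, by simpa using hχ, rfl⟩,
      (Finset.card_pos.mp hodd.pos).mono Finset.inter_subset_right⟩
  set c := 2 * Module.finrank k k⟮ε + algebraMap k K (-1) / ε⟯ *
      (2 * (Fintype.card O * Fintype.card O))
  let B := hfin.toFinset.filter fun χ => oddBlocks s χ ∈ 𝒜
  calc (Fintype.card J - 1) * c ≤ 𝒜.card * c := Nat.mul_le_mul_right _ hsep
    _ ≤ B.card := by
      rw [Finset.card_eq_sum_card_fiberwise (s := B) (f := oddBlocks s) (t := 𝒜)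
        (fun y hy => (Finset.mem_filter.mp hy).2), ← smul_eq_mul]
      refine Finset.card_nsmul_le_sum _ _ _ fun A hA => ?_
      obtain ⟨hA1, hA2⟩ := Finset.mem_filter.mp hA
      obtain ⟨χ, hχ, rfl⟩ := Finset.mem_image.mp hA1
      rw [Set.Finite.mem_toFinset] at hχ
      obtain ⟨j, hj, j', hj', hjj⟩ := Finset.one_lt_card.mp (by
        have := heven χ hχ
        have := hA2.card_pos
        grind : 1 < (oddBlocks s χ).card)
      refine (card_moved_characters_ge hs h2 hε hO hfin
        (fun χ hχ σ f q => weights_move hχ σ f q) hχ (hpow χ hχ) hjj hj hj').trans ?_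
      rw [← Set.ncard_coe_finset]
      refine Set.ncard_le_ncard ?_ (Finset.finite_toSet _)
      rintro ψ ⟨hψ, hψA⟩
      simp only [Finset.coe_filter, Set.mem_ofPred_eq, B, Finset.mem_filter, Set.Finite.mem_toFinset]
      exact ⟨⟨hψ, hψA ▸ hA⟩, hψA⟩
    _ ≤ hfin.toFinset.card := Finset.card_le_card (Finset.filter_subset _ _)
    _ ≤ d := hbound _ (by simp)

end LowerBound

section ColoredPermutations

theorem not_two_dvd_choose_two_pow_mul (v : ℕ) {l : ℕ} (hl : Odd l) :
    ¬ 2 ∣ (2 ^ v * l).choose (2 ^ v) := by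
  have : Fact (Nat.Prime 2) := ⟨Nat.prime_two⟩
  induction v with
  | zero => simpa using hl.not_two_dvd_nat
  | succ v ih =>
    have h := Choose.choose_modEq_choose_mod_mul_choose_div_nat
      (n := 2 ^ (v + 1) * l) (k := 2 ^ (v + 1)) (p := 2)
    have e₁ : 2 ^ (v + 1) = 2 * 2 ^ v := pow_succ' 2 v
    rw [e₁, mul_assoc, Nat.mul_mod_right, Nat.mul_mod_right, Nat.mul_div_cancel_left _ two_pos,
      Nat.mul_div_cancel_left _ two_pos, Nat.choose_self, one_mul] at h
    rw [e₁, mul_assoc]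
    exact fun h' => ih ((h.dvd_iff dvd_rfl).mp h')

theorem card_sylow_perm (b : ℕ) (P : Sylow 2 (Equiv.Perm (Fin b))) :
    Nat.card P = 2 ^ padicValNat 2 b.factorial := by
  have : Fact (Nat.Prime 2) := ⟨Nat.prime_two⟩
  rw [Sylow.card_eq_multiplicity, Nat.card_perm, Nat.card_eq_fintype_card, Fintype.card_fin,
    Nat.factorization_def _ Nat.prime_two]

/-- A two-group of permutations of `m` points of maximal order preserving a set of `b` points. -/
theorem exists_colored_perm_of_odd {v l : ℕ} (hl : Odd l) :
    ∃ (ι : Type) (_ : Fintype ι) (_ : DecidableEq ι) (R : Subgroup (Equiv.Perm ι)) (B : ι → Bool),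
      Fintype.card ι = 2 ^ v * l ∧ (∀ (r : R) i j, B (r • i) = B (r • j) → B i = B j) ∧
      Fintype.card {i // B i = true} = 2 ^ v ∧
      Fintype.card {i // ¬ B i = true} = 2 ^ v * l - 2 ^ v ∧
      Nat.card R = 2 ^ padicValNat 2 (2 ^ v * l).factorial := by
  have : Fact (Nat.Prime 2) := ⟨Nat.prime_two⟩
  set b := 2 ^ v with hb
  set m := b * l with hm
  have hbm : b ≤ m := Nat.le_mul_of_pos_right b hl.pos
  let P : Sylow 2 (Equiv.Perm (Fin b)) := default
  let Q : Sylow 2 (Equiv.Perm (Fin (m - b))) := default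
  refine ⟨Fin b ⊕ Fin (m - b), inferInstance, inferInstance,
    (P.1.prod Q.1).map (Equiv.Perm.sumCongrHom _ _), Sum.isLeft, ?_, ?_, ?_, ?_, ?_⟩
  · simp [hbm]
  · rintro ⟨_, ⟨⟨p, q⟩, -, rfl⟩⟩ (i | i) (j | j)
    all_goals first | exact fun _ => rfl | exact fun h => h
  · rw [Fintype.card_congr (Equiv.subtypeSum (p := fun i => Sum.isLeft i = true)), Fintype.card_sum]
    simp
  · rw [Fintype.card_congr (Equiv.subtypeSum (p := fun i => ¬ Sum.isLeft i = true)),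
      Fintype.card_sum]
    simp
  · rw [Nat.card_congr ((P.1.prod Q.1).equivMapOfInjective _
      Equiv.Perm.sumCongrHom_injective).toEquiv.symm,
      Nat.card_congr (Subgroup.prodEquiv P.1 Q.1).toEquiv, Nat.card_prod]
    rw [card_sylow_perm, card_sylow_perm, ← pow_add, ← Nat.choose_mul_factorial_mul_factorial hbm,
      padicValNat.mul (mul_ne_zero (Nat.choose_pos hbm).ne' (Nat.factorial_ne_zero _))
        (Nat.factorial_ne_zero _),
      padicValNat.mul (Nat.choose_pos hbm).ne' (Nat.factorial_ne_zero _),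
      padicValNat.eq_zero_of_not_dvd (not_two_dvd_choose_two_pow_mul v hl), zero_add]

theorem padicValNat_factorial_two_pow (t : ℕ) : padicValNat 2 (2 ^ t).factorial + 1 = 2 ^ t := by
  have : Fact (Nat.Prime 2) := ⟨Nat.prime_two⟩
  induction t with
  | zero => simp
  | succ t ih => rw [pow_succ' 2 t, padicValNat_factorial_mul]; omega

theorem multiplicative_zmod_two_decide (d a c : Multiplicative (ZMod 2))
    (h : decide (d * a = 1) = decide (d * c = 1)) : decide (a = 1) = decide (c = 1) := by
  revert d a c
  decide

theorem card_ne_one_multiplicative_zmod_two :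
    Fintype.card {c : Multiplicative (ZMod 2) // ¬ decide (c = 1) = true} = 1 := by
  decide

/-- A two-group of permutations of `2 ^ (t + 1)` points of maximal order preserving a
partition in two halves. -/
theorem exists_colored_perm_two_pow (t : ℕ) :
    ∃ (ι : Type) (_ : Fintype ι) (_ : DecidableEq ι) (R : Subgroup (Equiv.Perm ι)) (B : ι → Bool),
      Fintype.card ι = 2 ^ (t + 1) ∧ (∀ (r : R) i j, B (r • i) = B (r • j) → B i = B j) ∧
      Fintype.card {i // B i = true} = 2 ^ t ∧ Fintype.card {i // ¬ B i = true} = 2 ^ t ∧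
      Nat.card R = 2 ^ padicValNat 2 (2 ^ (t + 1)).factorial := by
  have : Fact (Nat.Prime 2) := ⟨Nat.prime_two⟩
  let P : Sylow 2 (Equiv.Perm (Fin (2 ^ t))) := default
  let C := Multiplicative (ZMod 2)
  refine ⟨Fin (2 ^ t) × C, inferInstance, inferInstance,
    (RegularWreathProduct.toPerm P C (Fin (2 ^ t))).range, fun u => u.2 = 1, ?_, ?_, ?_, ?_, ?_⟩
  · simp [C, pow_succ]
  · rintro ⟨_, ⟨w, rfl⟩⟩ ⟨i, a⟩ ⟨j, c⟩ h
    exact multiplicative_zmod_two_decide w.right a c h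
  · rw [Fintype.card_congr (Equiv.subtypeProdEquivSigmaSubtype
      (fun (_ : Fin (2 ^ t)) (c : C) => decide (c = 1) = true))]
    simp
  · rw [Fintype.card_congr (Equiv.subtypeProdEquivSigmaSubtype
      (fun (_ : Fin (2 ^ t)) (c : C) => ¬ decide (c = 1) = true))]
    rw [Fintype.card_sigma, Finset.sum_const, card_ne_one_multiplicative_zmod_two]
    simp
  · rw [Nat.card_congr (MonoidHom.ofInjective (RegularWreathProduct.toPermInj P C
      (Fin (2 ^ t)))).toEquiv.symm, RegularWreathProduct.card, card_sylow_perm]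
    have hC : Nat.card C = 2 := by simp [C]
    rw [hC, ← pow_mul, ← pow_succ]
    congr 1
    rw [pow_succ' 2 t, padicValNat_factorial_mul]
    have := padicValNat_factorial_two_pow t
    omega

end ColoredPermutations

section UpperBound

open Semidihedral PermWreath

variable {s : ℕ} {hs : 3 ≤ s}

theorem injective_of_isPrimitiveRoot {G K : Type*} [Group G] [Field K] {e : K}
    (he : IsPrimitiveRoot e (2 ^ s)) {ρ : Semidihedral s hs →* G}
    (h₁ : ∀ i, ρ (rot s hs ^ i) = 1 ↔ e ^ i = 1)
    (h₂ : ∀ i, ρ (rot s hs ^ i * Semidihedral.flip s hs) ≠ 1) : Function.Injective ρ := by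
  rw [injective_iff_map_eq_one]
  intro g hg
  obtain ⟨i, -, rfl | rfl⟩ := exists_eq g
  · rw [h₁, he.pow_eq_one_iff_dvd] at hg
    exact (rot_pow_eq_one_iff i).mpr hg
  · exact absurd hg (h₂ i)

theorem eq_one_or_eq_negOne_of_forall_commute (g : Semidihedral s hs) (hg : ∀ h, Commute g h) :
    g = 1 ∨ g = negOne s hs :=
  eq_one_or_eq_negOne_of_commute (hg _) (hg _)

variable {k K : Type*} [Field k] [Field K] [Algebra k K]

theorem exists_faithful_semidihedral_rep (hs : 3 ≤ s) {L : Type*} [Field L] [Algebra L K] {e : K}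
    (he : IsPrimitiveRoot e (2 ^ s)) {c : L} (hc : algebraMap L K c = e + e ^ twistExp s) :
    ∃ ρ : Semidihedral s hs →* Matrix.GeneralLinearGroup (Fin 2) L, Function.Injective ρ ∧
      (ρ (negOne s hs)).val = (-1 : L) • 1 := by
  obtain ⟨ρ, h₁, h₂, h₃⟩ := exists_semidihedral_rep (δ := (-1 : L)) hs he.pow_eq_one hc
    (by rw [he.pow_two_pow_pred hs, map_neg, map_one]) (he.pow_twistExp_ne hs).symm
  exact ⟨ρ, injective_of_isPrimitiveRoot he h₁ h₂, h₃⟩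

theorem exists_colored_rep (h2 : (-1 : k) ≠ 1) {ε : K} (hε : IsPrimitiveRoot ε (2 ^ s))
    [FiniteDimensional k k⟮ε + algebraMap k K (-1) / ε⟯] {R ι : Type*} [Group R] [MulAction R ι]
    [FaithfulSMul R ι] [Fintype ι] [DecidableEq ι] {B : ι → Bool}
    (hB : ∀ (r : R) i j, B (r • i) = B (r • j) → B i = B j) {a b : ℕ} (ha0 : 0 < a) (hb0 : 0 < b)
    (ha : Fintype.card {i // B i = true} = a) (hb : Fintype.card {i // ¬ B i = true} = b) :
    ∃ φ : PermWreath (Semidihedral s hs) R ι →* Matrix.GeneralLinearGroup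
      (Fin (Module.finrank k k⟮ε + algebraMap k K (-1) / ε⟯ * (2 * a * (2 * b)))) k,
      ∀ g, φ g = 1 ↔ g = 1 ∨ g = const R ι (negOne s hs) := by
  set E := k⟮ε + algebraMap k K (-1) / ε⟯
  have hneg : (-1 : E) ≠ 1 := fun h => h2 ((algebraMap k E).injective (by simpa using h))
  have hε0 : ε ≠ 0 := hε.ne_zero (by positivity)
  obtain ⟨ρ, hρ, hz⟩ := exists_faithful_semidihedral_rep hs (L := E) hε
    (c := ⟨_, mem_adjoin_simple_self k (ε + algebraMap k K (-1) / ε)⟩) (by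
      change ε + algebraMap k K (-1) / ε = _
      rw [pow_twistExp_eq_div ε hε0, hε.pow_two_pow_pred hs, map_neg, map_one])
  obtain ⟨⟨i₁, hi₁⟩⟩ := Fintype.card_pos_iff.mp (ha ▸ ha0)
  obtain ⟨⟨i₂, hi₂⟩⟩ := Fintype.card_pos_iff.mp (hb ▸ hb0)
  have : FiniteDimensional k (bipartiteForms E fun u : ι × Fin 2 => B u.1) :=
    FiniteDimensional.trans k E _
  obtain ⟨φ, hφ⟩ := exists_hom_GL_of_hom_end_extension (k := k) (formRep hB ρ)
    (d := Module.finrank k E * (2 * a * (2 * b))) (by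
      rw [finrank_bipartiteForms]
      congr 2
      · rw [Fintype.card_congr (Equiv.prodSubtypeFstEquivSubtypeProd
          (p := fun i => B i = true)), Fintype.card_prod, ha, Fintype.card_fin, mul_comm]
      · rw [Fintype.card_congr (Equiv.prodSubtypeFstEquivSubtypeProd
          (p := fun i => ¬ B i = true)), Fintype.card_prod, hb, Fintype.card_fin, mul_comm])
  exact ⟨φ, fun g => (hφ g).trans (formRep_eq_one_iff hB hρ hz
    eq_one_or_eq_negOne_of_forall_commute hneg ⟨i₁, hi₁⟩ ⟨i₂, by simpa using hi₂⟩ g)⟩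

end UpperBound

section Model

open Semidihedral PermWreath Matrix

theorem mem_range_algebraMap_of_pow_card_eq {F K : Type*} [Field F] [Fintype F] [Field K]
    [Algebra F K] {x : K} (hx : x ^ Fintype.card F = x) : ∃ c : F, algebraMap F K c = x := by
  have h : ∏ a : F, (Polynomial.X - Polynomial.C a) =
      (Polynomial.X ^ Fintype.card F - Polynomial.X : Polynomial F) := by
    have h := Polynomial.prod_multiset_X_sub_C_of_monic_of_roots_card_eq
      (p := (Polynomial.X ^ Fintype.card F - Polynomial.X : Polynomial F))
      (Polynomial.monic_X_pow_sub (by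
        rw [Polynomial.degree_X]; exact_mod_cast Fintype.one_lt_card))
      (by rw [FiniteField.roots_X_pow_card_sub_X,
        FiniteField.X_pow_card_sub_X_natDegree_eq F Fintype.one_lt_card]; rfl)
    rwa [FiniteField.roots_X_pow_card_sub_X] at h
  have h' := congrArg (Polynomial.aeval x) h
  rw [map_sub, map_pow, Polynomial.aeval_X, hx, sub_self, map_prod] at h'
  obtain ⟨a, -, ha⟩ := Finset.prod_eq_zero_iff.mp h'
  exact ⟨a, (sub_eq_zero.mp (by simpa using ha)).symm⟩

theorem three_le_of_mod_four {q s : ℕ} (hq4 : q % 4 = 3) (hs : s = padicValNat 2 (q + 1) + 1) :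
    3 ≤ s := by
  have : Fact (Nat.Prime 2) := ⟨Nat.prime_two⟩
  have : 2 ≤ padicValNat 2 (q + 1) :=
    (padicValNat_dvd_iff_le (by omega)).mp (by norm_num; omega)
  omega

variable {F : Type*} [Field F] [Fintype F] {s : ℕ}

theorem two_ne_zero_of_card_mod_four (hq4 : Fintype.card F % 4 = 3) : (2 : F) ≠ 0 :=
  Ring.two_ne_zero fun h => by have := FiniteField.even_card_of_char_two h; omega

theorem neg_one_ne_one_of_two_ne_zero {K : Type*} [Field K] (h : (2 : K) ≠ 0) : (-1 : K) ≠ 1 := by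
  intro h'
  apply h
  linear_combination -h'

theorem exists_trace_mem (hq4 : Fintype.card F % 4 = 3)
    (hs : s = padicValNat 2 (Fintype.card F + 1) + 1) :
    ∃ (ω : AlgebraicClosure F) (c : F), IsPrimitiveRoot ω (2 ^ s) ∧
      algebraMap F (AlgebraicClosure F) c = ω + ω ^ twistExp s := by
  have hp : Fact (Nat.Prime 2) := ⟨Nat.prime_two⟩
  have hs3 := three_le_of_mod_four hq4 hs
  have : NeZero ((2 ^ s : ℕ) : F) := ⟨by
    push_cast; exact pow_ne_zero _ (two_ne_zero_of_card_mod_four hq4)⟩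
  obtain ⟨ω, hω⟩ := HasEnoughRootsOfUnity.exists_primitiveRoot (AlgebraicClosure F) (2 ^ s)
  have hω0 := hω.ne_zero (by positivity)
  have hneg := hω.pow_two_pow_pred hs3
  obtain ⟨u, hu⟩ : 2 ^ (s - 1) ∣ Fintype.card F + 1 := by
    rw [hs, Nat.add_sub_cancel]; exact pow_padicValNat_dvd
  have hodd : Odd u := by
    rw [← Nat.not_even_iff_odd, even_iff_two_dvd]
    rintro ⟨w, rfl⟩
    refine pow_succ_padicValNat_not_dvd (p := 2) (n := Fintype.card F + 1) (by omega) ?_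
    rw [← hs, hu, two_pow_eq s hs3]
    exact ⟨w, by ring⟩
  have hq : ω ^ Fintype.card F = -1 / ω := by
    rw [eq_div_iff hω0, ← pow_succ, hu, pow_mul, hneg, hodd.neg_one_pow]
  have htw : ω ^ twistExp s = -1 / ω := by rw [pow_twistExp_eq_div ω hω0, hneg]
  have hoddq : Odd (Fintype.card F) := by rw [Nat.odd_iff]; omega
  obtain ⟨c, hc⟩ := mem_range_algebraMap_of_pow_card_eq (F := F) (x := ω + ω ^ twistExp s) (by
    have h := map_add (FiniteField.frobeniusAlgHom F (AlgebraicClosure F)) ω (ω ^ twistExp s)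
    simp only [FiniteField.coe_frobeniusAlgHom] at h
    rw [h, htw, div_pow, hq, hoddq.neg_one_pow]
    field_simp
    ring)
  exact ⟨ω, c, hω, hc⟩

theorem const_ne_one {S R ι : Type*} [Group S] [Group R] [MulAction R ι] [Nonempty ι] {z : S}
    (hz : z ≠ 1) : const R ι z ≠ 1 := by
  intro h
  obtain ⟨i⟩ := ‹Nonempty ι›
  exact hz (congrFun (congrArg SemidirectProduct.left h) i)

theorem card_ker_of_eq_one_iff {G H : Type*} [Group G] [Group H] (Φ : G →* H) {z : G} (hz : z ≠ 1)
    (h : ∀ g, Φ g = 1 ↔ g = 1 ∨ g = z) : Nat.card Φ.ker = 2 := by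
  have : (Φ.ker : Set G) = {1, z} := by
    ext g
    simp [MonoidHom.mem_ker, h]
  change Nat.card (Φ.ker : Set G) = 2
  rw [this, Nat.card_coe_set_eq, Set.ncard_pair hz.symm]

variable {R ι : Type*} [Group R] [MulAction R ι] [Fintype ι] [Nonempty ι]

theorem card_range_hom_PGL (hq4 : Fintype.card F % 4 = 3)
    (hs : s = padicValNat 2 (Fintype.card F + 1) + 1) {hs3 : 3 ≤ s} {m : ℕ} (hm0 : m ≠ 0)
    (hm : Fintype.card ι = m) (hR : Nat.card R = 2 ^ padicValNat 2 m.factorial)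
    {Φ : PermWreath (Semidihedral s hs3) R ι →*
      GL (Fin (2 * m)) F ⧸ Subgroup.center (GL (Fin (2 * m)) F)}
    (hΦ : ∀ g, Φ g = 1 ↔ g = 1 ∨ g = const R ι (negOne s hs3)) :
    Nat.card Φ.range = 2 ^ (Nat.card
      (GL (Fin (2 * m)) F ⧸ Subgroup.center (GL (Fin (2 * m)) F))).factorization 2 := by
  have h := card_range_mul_card_ker Φ
  rw [card_ker_of_eq_one_iff Φ (const_ne_one negOne_ne_one) hΦ, SemidirectProduct.card,
    Nat.card_fun, Semidihedral.card, hR, Nat.card_eq_fintype_card (α := ι), hm, ← pow_mul, ← pow_add] at h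
  have h₁ := padicValNat_card_PGL_add_one (F := F) hq4 (n := 2 * m) (by omega)
  rw [padicValNat_card_GL_two_mul hq4] at h₁
  rw [Nat.factorization_def _ Nat.prime_two]
  refine Nat.eq_of_mul_eq_mul_right two_pos ?_
  rw [h, ← pow_succ, h₁, hs]

variable [FaithfulSMul R ι] [DecidableEq ι]

theorem exists_hom_PGL (hq4 : Fintype.card F % 4 = 3)
    (hs : s = padicValNat 2 (Fintype.card F + 1) + 1) (hs3 : 3 ≤ s) {m : ℕ}
    (hm : Fintype.card ι = m) :
    ∃ Φ : PermWreath (Semidihedral s hs3) R ι →*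
      GL (Fin (2 * m)) F ⧸ Subgroup.center (GL (Fin (2 * m)) F),
      ∀ g, Φ g = 1 ↔ g = 1 ∨ g = const R ι (negOne s hs3) := by
  obtain ⟨ω, c, hω, hc⟩ := exists_trace_mem hq4 hs
  obtain ⟨ρ, hρ, hz⟩ := exists_faithful_semidihedral_rep hs3 hω hc
  have e : ι × Fin 2 ≃ Fin (2 * m) :=
    Fintype.equivFinOfCardEq (by rw [Fintype.card_prod, hm, Fintype.card_fin, mul_comm])
  let f : GL (ι × Fin 2) F ≃* GL (Fin (2 * m)) F :=
    Units.mapEquiv (Matrix.reindexAlgEquiv F F e).toMulEquiv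
  refine ⟨((QuotientGroup.mk' _).comp f.toMonoidHom).comp (monomialGL ρ), fun g => ?_⟩
  rw [← monomialGL_mem_center_iff hρ hz eq_one_or_eq_negOne_of_forall_commute
    (neg_one_ne_one_of_two_ne_zero (two_ne_zero_of_card_mod_four hq4)) g]
  change ((f (monomialGL ρ g) : GL (Fin (2 * m)) F) :
    GL (Fin (2 * m)) F ⧸ Subgroup.center (GL (Fin (2 * m)) F)) = 1 ↔ _
  rw [QuotientGroup.eq_one_iff, Subgroup.mem_center_iff, Subgroup.mem_center_iff]
  constructor
  · intro h x
    apply f.injective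
    rw [map_mul, map_mul, h]
  · intro h x
    obtain ⟨y, rfl⟩ := f.surjective x
    rw [← map_mul, ← map_mul, h]

end Model

section TraceDegree

variable {k K : Type*} [Field k] [Field K] [Algebra k K] [Normal k K]

theorem exists_algEquiv_adjoin_iff_div {e : K} {δ : k} (hδ : δ ≠ 0) {f' : k⟮e⟯}
    (hf' : (f' : K) = algebraMap k K δ / e) :
    (∃ σ : k⟮e⟯ ≃ₐ[k] k⟮e⟯, σ (AdjoinSimple.gen k e) = f') ↔
      ∃ σ : K ≃ₐ[k] K, σ e = algebraMap k K δ / e := by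
  refine exists_algEquiv_adjoin_iff hf' ?_
  have h : e = algebraMap k K δ / (algebraMap k K δ / e) :=
    (div_div_cancel₀ ((map_ne_zero _).mpr hδ)).symm
  have hmem := div_mem (IntermediateField.algebraMap_mem k⟮algebraMap k K δ / e⟯ δ)
    (mem_adjoin_simple_self k (algebraMap k K δ / e))
  rwa [← h] at hmem

variable {N : ℕ} {e : K} {δ : k} {f' : k⟮e⟯}

theorem two_mul_finrank_trace_eq (hN : (N : k) ≠ 0) (he : e ^ N = 1) (hδ : δ ≠ 0)
    (hne : e ≠ algebraMap k K δ / e) (hf' : (f' : K) = algebraMap k K δ / e)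
    (h : ∃ σ : k⟮e⟯ ≃ₐ[k] k⟮e⟯, σ (AdjoinSimple.gen k e) = f') :
    2 * Module.finrank k k⟮e + algebraMap k K δ / e⟯ = Module.finrank k k⟮e⟯ := by
  have he0 : e ≠ 0 := by
    rintro rfl
    exact zero_ne_one ((zero_pow (by rintro rfl; simp at hN)).symm.trans he)
  exact two_mul_finrank_eq_of_exists he0 hδ hne (isSeparable_add_div hN he δ)
    (isSeparable_of_pow_eq_one hN he) ((exists_algEquiv_adjoin_iff_div hδ hf').mp h)

theorem finrank_trace_eq (hN : (N : k) ≠ 0) (he : e ^ N = 1) (hδ : δ ≠ 0)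
    (hf' : (f' : K) = algebraMap k K δ / e)
    (h : ¬ ∃ σ : k⟮e⟯ ≃ₐ[k] k⟮e⟯, σ (AdjoinSimple.gen k e) = f') :
    Module.finrank k k⟮e + algebraMap k K δ / e⟯ = Module.finrank k k⟮e⟯ := by
  have he0 : e ≠ 0 := by
    rintro rfl
    exact zero_ne_one ((zero_pow (by rintro rfl; simp at hN)).symm.trans he)
  exact finrank_eq_of_not_exists he0 (isSeparable_add_div hN he δ)
    (isSeparable_of_pow_eq_one hN he) (mt (exists_algEquiv_adjoin_iff_div hδ hf').mpr h)

end TraceDegree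

section EvenDegree

open Semidihedral PermWreath Matrix

theorem isPGroup_permWreath {R ι : Type*} [Group R] [MulAction R ι] [Finite ι] {s : ℕ}
    {hs : 3 ≤ s} {c : ℕ} (hR : Nat.card R = 2 ^ c) :
    IsPGroup 2 (PermWreath (Semidihedral s hs) R ι) := by
  have : Fact (Nat.Prime 2) := ⟨Nat.prime_two⟩
  apply IsPGroup.of_card (n := (s + 1) * Nat.card ι + c)
  rw [SemidirectProduct.card, Nat.card_fun, Semidihedral.card, hR, ← pow_mul, ← pow_add]

variable {F : Type*} [Field F] [Fintype F] {s : ℕ} {k K : Type*} [Field k] [Field K] [Algebra k K]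
  [IsAlgClosed K] [Normal k K] {ι : Type*} [Fintype ι] [DecidableEq ι]

theorem minFaithfulDim_sylow_PGL_two_mul (hq4 : Fintype.card F % 4 = 3)
    (hs : s = padicValNat 2 (Fintype.card F + 1) + 1) (h2 : (-1 : k) ≠ 1) {ε : K}
    (hε : IsPrimitiveRoot ε (2 ^ s)) {R : Subgroup (Equiv.Perm ι)} {B : ι → Bool} {v l a b : ℕ}
    (hl : 2 ≤ l) (hι : Fintype.card ι = 2 ^ v * l)
    (hB : ∀ (r : R) i j, B (r • i) = B (r • j) → B i = B j)
    (ha : Fintype.card {i // B i = true} = a) (hb : Fintype.card {i // ¬ B i = true} = b)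
    (hR : Nat.card R = 2 ^ padicValNat 2 (2 ^ v * l).factorial)
    (hab : a * b = (l - 1) * (2 ^ v * 2 ^ v))
    (P : Sylow 2 (GL (Fin (2 * (2 ^ v * l))) F ⧸
      Subgroup.center (GL (Fin (2 * (2 ^ v * l))) F))) :
    minFaithfulDim k P =
      Module.finrank k k⟮ε + algebraMap k K (-1) / ε⟯ * (2 * a * (2 * b)) := by
  have hs3 := three_le_of_mod_four hq4 hs
  have hpos : 0 < a * b := by
    rw [hab]
    have : 0 < l - 1 := by omega
    positivity
  have hm0 : 2 ^ v * l ≠ 0 := by positivity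
  have : Nonempty ι := Fintype.card_pos_iff.mp (by omega)
  have : FiniteDimensional k k⟮ε + algebraMap k K (-1) / ε⟯ :=
    adjoin.finiteDimensional (Normal.isIntegral inferInstance _)
  obtain ⟨Φ, hΦ⟩ := exists_hom_PGL (R := R) hq4 hs hs3 hι
  obtain ⟨φ, hφ⟩ := exists_colored_rep (hs := hs3) h2 hε hB (Nat.pos_of_mul_pos_right hpos)
    (Nat.pos_of_mul_pos_left hpos) ha hb
  have : NeZero l := ⟨by omega⟩
  let O := Multiplicative (ZMod (2 ^ v))
  have hO : Fintype.card O = 2 ^ v := by simp [O]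
  obtain ⟨Ψ, hΨ⟩ := exists_hom_PGL (R := Fin l → O) (ι := Fin l × O) (m := 2 ^ v * l) hq4 hs hs3
    (by rw [Fintype.card_prod, hO, Fintype.card_fin, mul_comm])
  refine minFaithfulDim_sylow_eq P (card_range_hom_PGL hq4 hs hm0 hι hR hΦ)
    (fun g => (hφ g).trans (hΦ g).symm)
    (isPGroup_permWreath (R := Fin l → O) (ι := Fin l × O) (c := v * l) (by
      rw [Nat.card_fun, Nat.card_eq_fintype_card (α := O), hO, Nat.card_fin, pow_mul])) Ψ ?_
  intro d' ψ hψ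
  have h := le_dim_of_kernel_eq (v := v) h2 hε (fun w : O => ofAdd_pow_card _ w) ψ
    fun g => (hψ g).trans (hΨ g)
  rw [hO, Fintype.card_fin] at h
  refine le_trans (le_of_eq ?_) h
  linear_combination 4 * Module.finrank k k⟮ε + algebraMap k K (-1) / ε⟯ * hab

theorem minFaithfulDim_sylow_PGL_of_odd (hq4 : Fintype.card F % 4 = 3)
    (hs : s = padicValNat 2 (Fintype.card F + 1) + 1) (h2 : (-1 : k) ≠ 1) {ε : K}
    (hε : IsPrimitiveRoot ε (2 ^ s)) {v l : ℕ} (hl : Odd l) (hl2 : 2 ≤ l)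
    (P : Sylow 2 (GL (Fin (2 * (2 ^ v * l))) F ⧸
      Subgroup.center (GL (Fin (2 * (2 ^ v * l))) F))) :
    minFaithfulDim k P = Module.finrank k k⟮ε + algebraMap k K (-1) / ε⟯ *
      (2 * 2 ^ v * (2 * (2 ^ v * l - 2 ^ v))) := by
  obtain ⟨ι, _, _, R, B, hι, hB, ha, hb, hR⟩ := exists_colored_perm_of_odd (v := v) hl
  refine minFaithfulDim_sylow_PGL_two_mul hq4 hs h2 hε hl2 hι hB ha hb hR ?_ P
  obtain ⟨j, rfl⟩ := Nat.exists_eq_add_of_le' hl.pos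
  have : 2 ^ v * (j + 1) - 2 ^ v = 2 ^ v * j := by rw [mul_add, mul_one, Nat.add_sub_cancel]
  rw [this, Nat.add_sub_cancel]
  ring

theorem minFaithfulDim_sylow_PGL_two_pow (hq4 : Fintype.card F % 4 = 3)
    (hs : s = padicValNat 2 (Fintype.card F + 1) + 1) (h2 : (-1 : k) ≠ 1) {ε : K}
    (hε : IsPrimitiveRoot ε (2 ^ s)) {t : ℕ}
    (P : Sylow 2 (GL (Fin (2 * (2 ^ t * 2))) F ⧸ Subgroup.center (GL (Fin (2 * (2 ^ t * 2))) F))) :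
    minFaithfulDim k P = Module.finrank k k⟮ε + algebraMap k K (-1) / ε⟯ *
      (2 * 2 ^ t * (2 * 2 ^ t)) := by
  obtain ⟨ι, _, _, R, B, hι, hB, ha, hb, hR⟩ := exists_colored_perm_two_pow t
  exact minFaithfulDim_sylow_PGL_two_mul hq4 hs h2 hε le_rfl hι hB ha hb hR (by ring) P

end EvenDegree

section DegreeTwo

open Semidihedral Matrix

variable {s : ℕ} {hs : 3 ≤ s}

theorem two_pow_pred_eq (hs : 3 ≤ s) : 2 ^ (s - 1) = 2 * 2 ^ (s - 2) := by
  rw [← pow_succ']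
  congr 1
  omega

theorem rot_pow_eq_one_or_negOne {i : ℕ} (h : 2 ^ (s - 1) ∣ i) :
    rot s hs ^ i = 1 ∨ rot s hs ^ i = negOne s hs := by
  obtain ⟨j, rfl⟩ := h
  rw [pow_mul]
  change negOne s hs ^ j = 1 ∨ negOne s hs ^ j = negOne s hs
  obtain ⟨i, rfl | rfl⟩ := Nat.even_or_odd' j
  · left
    rw [pow_mul, negOne_sq, one_pow]
  · right
    rw [pow_succ, pow_mul, negOne_sq, one_pow, one_mul]

theorem mem_center_iff_of_val_negOne {L : Type*} [Field L]
    {ρ : Semidihedral s hs →* GL (Fin 2) L} (hρ : Function.Injective ρ)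
    (hz : (ρ (negOne s hs)).val = (-1 : L) • 1) (g : Semidihedral s hs) :
    ρ g ∈ Subgroup.center (GL (Fin 2) L) ↔ g = 1 ∨ g = negOne s hs := by
  constructor
  · intro h
    refine eq_one_or_eq_negOne_of_forall_commute g fun h' => hρ ?_
    rw [map_mul, map_mul]
    exact (Subgroup.mem_center_iff.mp h _).symm
  · rintro (rfl | rfl)
    · rw [map_one]
      exact one_mem _
    · refine Subgroup.mem_center_iff.mpr fun x => Units.ext ?_
      rw [Units.val_mul, Units.val_mul, hz]
      simp

theorem IsPrimitiveRoot.pow_twistExp_eq_inv {K : Type*} [Field K] {ξ : K}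
    (hξ : IsPrimitiveRoot ξ (2 ^ (s - 1))) : ξ ^ twistExp s = 1 / ξ := by
  rw [pow_twistExp_eq_div ξ (hξ.ne_zero (by positivity)), hξ.pow_eq_one]

theorem IsPrimitiveRoot.ne_one_div {K : Type*} [Field K] (hs : 3 ≤ s) {ξ : K}
    (hξ : IsPrimitiveRoot ξ (2 ^ (s - 1))) : ξ ≠ 1 / ξ := by
  intro h
  rw [eq_div_iff (hξ.ne_zero (by positivity)), ← sq, hξ.pow_eq_one_iff_dvd] at h
  have h4 : 2 ^ 2 ≤ 2 ^ (s - 1) := Nat.pow_le_pow_right (by norm_num) (by omega)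
  have := Nat.le_of_dvd two_pos h
  omega

variable {k K : Type*} [Field k] [Field K] [Algebra k K]

theorem exists_dihedral_rep (hs : 3 ≤ s) {ξ : K} (hξ : IsPrimitiveRoot ξ (2 ^ (s - 1)))
    [FiniteDimensional k k⟮ξ + algebraMap k K 1 / ξ⟯] :
    ∃ φ : Semidihedral s hs →*
      GL (Fin (Module.finrank k k⟮ξ + algebraMap k K 1 / ξ⟯ * 2)) k,
      ∀ g, φ g = 1 ↔ g = 1 ∨ g = negOne s hs := by
  set E := k⟮ξ + algebraMap k K 1 / ξ⟯
  have hτ := hξ.pow_twistExp_eq_inv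
  obtain ⟨ρ, h₁, h₂, -⟩ := exists_semidihedral_rep (L := E) (δ := 1) hs
    (e := ξ) (by rw [two_pow_eq s hs, mul_comm, pow_mul, hξ.pow_eq_one, one_pow])
    (c := ⟨_, mem_adjoin_simple_self k (ξ + algebraMap k K 1 / ξ)⟩) (by
      change ξ + algebraMap k K 1 / ξ = _
      rw [hτ, map_one]) (by rw [map_one, hξ.pow_eq_one])
    (by rw [hτ]; exact (hξ.ne_one_div hs).symm)
  have : FiniteDimensional k (Fin 2 → E) := FiniteDimensional.trans k E _
  obtain ⟨φ, hφ⟩ := exists_hom_GL_of_hom_end_extension (k := k) (E := E) (V := Fin 2 → E)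
    ((Matrix.toLinAlgEquiv' : Matrix (Fin 2) (Fin 2) E ≃ₐ[E] _).toAlgHom.toMonoidHom.comp
      ((Units.coeHom _).comp ρ)) (d := Module.finrank k E * 2) (by rw [Module.finrank_fin_fun])
  refine ⟨φ, fun g => (hφ g).trans ?_⟩
  have h : Matrix.toLinAlgEquiv' (ρ g).val = (1 : Module.End E (Fin 2 → E)) ↔ ρ g = 1 := by
    rw [← map_one (Matrix.toLinAlgEquiv' : Matrix (Fin 2) (Fin 2) E ≃ₐ[E] _),
      EmbeddingLike.apply_eq_iff_eq, ← Units.val_one, Units.ext_iff]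
  refine h.trans ?_
  constructor
  · intro hg
    obtain ⟨i, -, rfl | rfl⟩ := exists_eq g
    · rw [h₁, hξ.pow_eq_one_iff_dvd] at hg
      exact rot_pow_eq_one_or_negOne hg
    · exact absurd hg (h₂ i)
  · rintro (rfl | rfl)
    · exact map_one ρ
    · rw [negOne, h₁, hξ.pow_eq_one]

theorem le_dim_of_kernel_eq_negOne [IsAlgClosed K] [Normal k K] (h2 : (2 : k) ≠ 0) {ξ : K}
    (hξ : IsPrimitiveRoot ξ (2 ^ (s - 1))) {d : ℕ} (θ : Semidihedral s hs →* GL (Fin d) k)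
    (hθ : ∀ g, θ g = 1 ↔ g = 1 ∨ g = negOne s hs) :
    Module.finrank k k⟮ξ + algebraMap k K 1 / ξ⟯ * 2 ≤ d := by
  have hp : Fact (Nat.Prime 2) := ⟨Nat.prime_two⟩
  have h2K : (-1 : K) ≠ 1 := neg_one_ne_one_of_two_ne_zero fun h =>
    h2 ((algebraMap k K).injective (by rw [map_ofNat, map_zero, h]))
  set T := scalarExtension K θ
  set x : Unit → Semidihedral s hs := fun _ => rot s hs
  have hcomm : ∀ i j, Commute (x i) (x j) := fun _ _ => Commute.refl _
  have hbound : ∀ S : Finset (Unit → K), ↑S ⊆ weights T x → S.card ≤ d := fun S hS => by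
    simpa using card_le_finrank_of_subset_weights hcomm hS
  have hfin : (weights T x).Finite := by
    by_contra hinf
    obtain ⟨S, hS, hcard⟩ := Set.Infinite.exists_subset_card_eq hinf (d + 1)
    have := hbound S hS
    omega
  have hker : ∀ g, T g = 1 ↔ g = 1 ∨ g = negOne s hs := fun g =>
    (scalarExtension_eq_one_iff θ g).trans (hθ g)
  have hz2 : (rot s hs ^ 2 ^ (s - 2)) ^ 2 = negOne s hs := by
    rw [← pow_mul, mul_comm, ← two_pow_pred_eq hs, negOne]
  have hz : T (rot s hs ^ 2 ^ (s - 2)) ≠ 1 := by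
    rw [Ne, hker]
    rintro (h | h)
    · exact negOne_ne_one (hs := hs) (by rw [← hz2, h, one_pow])
    · exact negOne_ne_one (hs := hs) (by rw [← hz2, h, negOne_sq])
  obtain ⟨χ, v, hv, hneg, h⟩ := exists_mem_weights_neg (T := T) (x := x) hcomm
    (fun i => (Commute.refl _).pow_left _) ((hker _).mpr (Or.inr hz2)) hz
  have hχ : χ ∈ weights T x := ⟨v, hv, h⟩
  set e := χ ()
  have he1 : e ^ 2 ^ (s - 2) = -1 := by
    refine smul_left_injective K hv ?_
    change e ^ 2 ^ (s - 2) • v = (-1 : K) • v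
    rw [← apply_pow_of_apply_eq_smul (h ()), neg_one_smul]
    exact hneg
  have he : IsPrimitiveRoot e (2 ^ (s - 1)) := by
    have ho := orderOf_eq_prime_pow (p := 2) (n := s - 2) (x := e) (by rw [he1]; exact h2K)
      (by rw [pow_succ, pow_mul, he1, neg_one_sq])
    rw [show s - 2 + 1 = s - 1 by omega] at ho
    exact ho ▸ IsPrimitiveRoot.orderOf e
  have hχ' : (fun _ => algebraMap k K 1 / e) ∈ weights T x := by
    rw [map_one, ← he.pow_twistExp_eq_inv]
    exact mem_weights_of_conj hχ (Semidihedral.flip s hs) (π := id) fun _ => flip_rot_flip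
  have hN : ((2 ^ (s - 1) : ℕ) : k) ≠ 0 := by
    push_cast
    exact pow_ne_zero _ h2
  have hle := two_mul_finrank_le_ncard (k := k) (δ := 1) one_ne_zero
    (by rw [map_one]; exact he.ne_one_div hs)
    (isSeparable_add_div hN he.pow_eq_one 1)
    (hfin.image fun ψ => ψ ()) (fun σ => ⟨_, mem_weights_of_algEquiv hχ σ, rfl⟩)
    (fun σ => ⟨_, mem_weights_of_algEquiv hχ' σ, rfl⟩)
  rw [finrank_adjoin_add_div_eq (e := e) (dvd_pow_self 2 (by omega)) he hξ (one_pow 2), mul_comm]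
  refine hle.trans ((Set.ncard_image_le hfin).trans ?_)
  rw [Set.ncard_eq_toFinset_card _ hfin]
  exact hbound _ (by simp)

variable {F : Type*} [Field F] [Fintype F]

theorem minFaithfulDim_sylow_PGL_two [IsAlgClosed K] [Normal k K] (hq4 : Fintype.card F % 4 = 3)
    (hs : s = padicValNat 2 (Fintype.card F + 1) + 1) (h2 : (2 : k) ≠ 0) {ξ : K}
    (hξ : IsPrimitiveRoot ξ (2 ^ (s - 1)))
    (P : Sylow 2 (GL (Fin 2) F ⧸ Subgroup.center (GL (Fin 2) F))) :
    minFaithfulDim k P = Module.finrank k k⟮ξ + algebraMap k K 1 / ξ⟯ * 2 := by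
  have hp : Fact (Nat.Prime 2) := ⟨Nat.prime_two⟩
  have hs3 := three_le_of_mod_four hq4 hs
  have : FiniteDimensional k k⟮ξ + algebraMap k K 1 / ξ⟯ :=
    adjoin.finiteDimensional (Normal.isIntegral inferInstance _)
  obtain ⟨ω, c, hω, hc⟩ := exists_trace_mem hq4 hs
  obtain ⟨ρ, hρ, hz⟩ := exists_faithful_semidihedral_rep hs3 hω hc
  let Φ : Semidihedral s hs3 →* GL (Fin 2) F ⧸ Subgroup.center (GL (Fin 2) F) :=
    (QuotientGroup.mk' _).comp ρ
  have hΦ : ∀ g, Φ g = 1 ↔ g = 1 ∨ g = negOne s hs3 := fun g =>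
    (QuotientGroup.eq_one_iff (ρ g)).trans (mem_center_iff_of_val_negOne hρ hz g)
  obtain ⟨φ, hφ⟩ := exists_dihedral_rep (k := k) hs3 hξ
  refine minFaithfulDim_sylow_eq P (Φ := Φ) ?_ (fun g => (hφ g).trans (hΦ g).symm)
    (IsPGroup.of_card Semidihedral.card) Φ
    fun d' ψ hψ => le_dim_of_kernel_eq_negOne h2 hξ ψ fun g => (hψ g).trans (hΦ g)
  have h := card_range_mul_card_ker Φ
  rw [card_ker_of_eq_one_iff Φ negOne_ne_one hΦ, Semidihedral.card] at h
  have h₁ := padicValNat_card_PGL_add_one (F := F) hq4 (n := 2) two_ne_zero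
  have h₂ := padicValNat_card_GL_two_mul hq4 1
  rw [mul_one, mul_one, Nat.factorial_one, padicValNat_one_right, add_zero] at h₂
  rw [h₂] at h₁
  rw [Nat.factorization_def _ Nat.prime_two]
  refine Nat.eq_of_mul_eq_mul_right two_pos ?_
  rw [h, ← pow_succ, h₁, hs]

end DegreeTwo

section OddDegree

open Matrix

theorem minFaithfulDim_sylow_congr {G H : Type*} [Group G] [Group H] [Finite G] [Finite H] {p : ℕ}
    [Fact p.Prime] {f : H →* G} (hf : Function.Injective f)
    (h : (Nat.card G).factorization p = (Nat.card H).factorization p) (P : Sylow p G)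
    (Q : Sylow p H) (k : Type*) [Field k] : minFaithfulDim k P = minFaithfulDim k Q := by
  let e : Q ≃* Subgroup.map f Q := Q.toSubgroup.equivMapOfInjective f hf
  have hcard : Nat.card (Subgroup.map f Q) = p ^ (Nat.card G).factorization p := by
    rw [← Nat.card_congr e.toEquiv, h, Q.card_eq_multiplicity]
  let e' : P ≃* Sylow.ofCard (Subgroup.map f Q) hcard := P.equiv _
  exact minFaithfulDim_congr k (e'.trans e.symm)

/-- Bordering a matrix by a single `1`. -/
def borderHom (n : ℕ) (F : Type*) [Field F] :
    Matrix (Fin n) (Fin n) F →* Matrix (Fin n ⊕ Unit) (Fin n ⊕ Unit) F where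
  toFun M := fromBlocks M 0 0 1
  map_one' := fromBlocks_one
  map_mul' M N := by simp [fromBlocks_multiply]

theorem exists_injective_GL_PGL (n : ℕ) (F : Type*) [Field F] :
    ∃ f : GL (Fin n) F →* GL (Fin (n + 1)) F ⧸ Subgroup.center (GL (Fin (n + 1)) F),
      Function.Injective f := by
  let e : Fin n ⊕ Unit ≃ Fin (n + 1) := Fintype.equivFinOfCardEq (by simp)
  let r : GL (Fin n ⊕ Unit) F ≃* GL (Fin (n + 1)) F :=
    Units.mapEquiv (Matrix.reindexAlgEquiv F F e).toMulEquiv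
  refine ⟨(QuotientGroup.mk' _).comp (r.toMonoidHom.comp (Units.map (borderHom n F))), ?_⟩
  rw [injective_iff_map_eq_one]
  intro g hg
  have hg' := Subgroup.mem_center_iff.mp ((QuotientGroup.eq_one_iff _).mp hg)
  obtain ⟨c, hc⟩ : ∃ c : F, scalar (Fin n ⊕ Unit) c = fromBlocks g.val 0 0 1 := by
    refine mem_range_scalar_of_commute_transvectionStruct fun t => ?_
    let u : GL (Fin n ⊕ Unit) F := ⟨t.toMatrix, t.inv.toMatrix, t.mul_inv, t.inv_mul⟩
    have h : r (u * Units.map (borderHom n F) g) = r (Units.map (borderHom n F) g * u) := by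
      rw [map_mul, map_mul]
      exact hg' (r u)
    exact congrArg Units.val (r.injective h)
  have hc1 : c = 1 := by simpa using congrFun (congrFun hc (Sum.inr ())) (Sum.inr ())
  rw [hc1, map_one, ← fromBlocks_one, fromBlocks_inj] at hc
  exact Units.ext hc.1.symm

theorem minFaithfulDim_sylow_PGL_odd {F : Type*} [Field F] [Fintype F]
    (hq4 : Fintype.card F % 4 = 3) {n : ℕ} (hn : Even n)
    (P : Sylow 2 (GL (Fin (n + 1)) F ⧸ Subgroup.center (GL (Fin (n + 1)) F)))
    (Q : Sylow 2 (GL (Fin n) F)) (k : Type*) [Field k] :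
    minFaithfulDim k P = minFaithfulDim k Q := by
  have hp : Fact (Nat.Prime 2) := ⟨Nat.prime_two⟩
  obtain ⟨f, hf⟩ := exists_injective_GL_PGL n F
  refine minFaithfulDim_sylow_congr hf ?_ P Q k
  rw [Nat.factorization_def _ Nat.prime_two, Nat.factorization_def _ Nat.prime_two]
  have h := padicValNat_card_PGL_add_one (F := F) hq4 (n := n + 1) (by omega)
  rw [padicValNat_card_GL hq4, Finset.sum_range_succ, ← padicValNat_card_GL hq4,
    padicValNat_pow_sub_one_of_odd hq4 hn.add_one] at h
  exact Nat.add_right_cancel h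

end OddDegree

section Assembly

variable {s : ℕ} {k K : Type*} [Field k] [Field K] [Algebra k K] [Normal k K]

theorem two_mul_finrank_twisted_trace_eq (hs : 3 ≤ s) (h2 : (2 : k) ≠ 0) {ε : K}
    (hε : IsPrimitiveRoot ε (2 ^ s))
    (h : ∃ σ : k⟮ε⟯ ≃ₐ[k] k⟮ε⟯,
      σ (AdjoinSimple.gen k ε) = (AdjoinSimple.gen k ε) ^ (2 ^ (s - 1) - 1)) :
    2 * Module.finrank k k⟮ε + algebraMap k K (-1) / ε⟯ = Module.finrank k k⟮ε⟯ := by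
  have hdiv : ε ^ twistExp s = algebraMap k K (-1) / ε := by
    rw [pow_twistExp_eq_div ε (hε.ne_zero (by positivity)), hε.pow_two_pow_pred hs, map_neg,
      map_one]
  refine two_mul_finrank_trace_eq (N := 2 ^ s) ?_ hε.pow_eq_one (neg_ne_zero.mpr one_ne_zero)
    (hdiv ▸ hε.pow_twistExp_ne hs) ?_ h
  · push_cast
    exact pow_ne_zero _ h2
  · rw [← hdiv]
    rfl

theorem finrank_twisted_trace_eq (hs : 3 ≤ s) (h2 : (2 : k) ≠ 0) {ε : K}
    (hε : IsPrimitiveRoot ε (2 ^ s))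
    (h : ¬ ∃ σ : k⟮ε⟯ ≃ₐ[k] k⟮ε⟯,
      σ (AdjoinSimple.gen k ε) = (AdjoinSimple.gen k ε) ^ (2 ^ (s - 1) - 1)) :
    Module.finrank k k⟮ε + algebraMap k K (-1) / ε⟯ = Module.finrank k k⟮ε⟯ := by
  refine finrank_trace_eq (N := 2 ^ s) ?_ hε.pow_eq_one (neg_ne_zero.mpr one_ne_zero) ?_ h
  · push_cast
    exact pow_ne_zero _ h2
  · rw [map_neg, map_one, ← hε.pow_two_pow_pred hs,
      ← pow_twistExp_eq_div ε (hε.ne_zero (by positivity))]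
    rfl

theorem two_mul_finrank_trace_eq_of_inv (hs : 3 ≤ s) (h2 : (2 : k) ≠ 0) {ξ : K}
    (hξ : IsPrimitiveRoot ξ (2 ^ (s - 1)))
    (h : ∃ σ : k⟮ξ⟯ ≃ₐ[k] k⟮ξ⟯, σ (AdjoinSimple.gen k ξ) = (AdjoinSimple.gen k ξ)⁻¹) :
    2 * Module.finrank k k⟮ξ + algebraMap k K 1 / ξ⟯ = Module.finrank k k⟮ξ⟯ := by
  refine two_mul_finrank_trace_eq (N := 2 ^ (s - 1)) ?_ hξ.pow_eq_one one_ne_zero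
    (by rw [map_one]; exact hξ.ne_one_div hs) ?_ h
  · push_cast
    exact pow_ne_zero _ h2
  · rw [map_one, one_div]
    rfl

theorem finrank_trace_eq_of_not_inv (h2 : (2 : k) ≠ 0) {ξ : K}
    (hξ : IsPrimitiveRoot ξ (2 ^ (s - 1)))
    (h : ¬ ∃ σ : k⟮ξ⟯ ≃ₐ[k] k⟮ξ⟯, σ (AdjoinSimple.gen k ξ) = (AdjoinSimple.gen k ξ)⁻¹) :
    Module.finrank k k⟮ξ + algebraMap k K 1 / ξ⟯ = Module.finrank k k⟮ξ⟯ := by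
  refine finrank_trace_eq (N := 2 ^ (s - 1)) ?_ hξ.pow_eq_one one_ne_zero ?_ h
  · push_cast
    exact pow_ne_zero _ h2
  · rw [map_one, one_div]
    rfl

variable {F : Type*} [Field F] [Fintype F]

theorem minFaithfulDim_sylow_PGL_not_two_pow [IsAlgClosed K] (hq4 : Fintype.card F % 4 = 3)
    (hs : s = padicValNat 2 (Fintype.card F + 1) + 1) (h2 : (2 : k) ≠ 0) {ε : K}
    (hε : IsPrimitiveRoot ε (2 ^ s)) {m : ℕ} (hm : 2 ≤ m) (hpow : ∀ t : ℕ, m ≠ 2 ^ t)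
    (P : Sylow 2 (Matrix.GeneralLinearGroup (Fin (2 * m)) F ⧸
      Subgroup.center (Matrix.GeneralLinearGroup (Fin (2 * m)) F))) :
    minFaithfulDim k P = 2 ^ (1 + padicValNat 2 m) * (m - 2 ^ padicValNat 2 m) *
      (2 * Module.finrank k k⟮ε + algebraMap k K (-1) / ε⟯) := by
  have hp : Fact (Nat.Prime 2) := ⟨Nat.prime_two⟩
  obtain ⟨l, hl⟩ : 2 ^ padicValNat 2 m ∣ m := pow_padicValNat_dvd
  have hodd : Odd l := by
    rw [← Nat.not_even_iff_odd, even_iff_two_dvd]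
    rintro ⟨w, rfl⟩
    exact pow_succ_padicValNat_not_dvd (p := 2) (n := m) (by omega)
      ⟨w, by rw [pow_succ, mul_assoc, ← hl]⟩
  have hl1 : l ≠ 1 := fun h => hpow (padicValNat 2 m) (by rw [h, mul_one] at hl; exact hl)
  have hl2 : 2 ≤ l := by
    have := hodd.pos
    omega
  generalize padicValNat 2 m = v at hl ⊢
  subst hl
  rw [minFaithfulDim_sylow_PGL_of_odd hq4 hs (neg_one_ne_one_of_two_ne_zero h2) hε hodd hl2 P]
  ring

theorem minFaithfulDim_sylow_PGL_two_mul_two_pow [IsAlgClosed K] (hq4 : Fintype.card F % 4 = 3)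
    (hs : s = padicValNat 2 (Fintype.card F + 1) + 1) (h2 : (2 : k) ≠ 0) {ε : K}
    (hε : IsPrimitiveRoot ε (2 ^ s)) {t : ℕ} (ht : 1 ≤ t)
    (P : Sylow 2 (Matrix.GeneralLinearGroup (Fin (2 * 2 ^ t)) F ⧸
      Subgroup.center (Matrix.GeneralLinearGroup (Fin (2 * 2 ^ t)) F))) :
    minFaithfulDim k P = 2 ^ (2 * t - 1) *
      (2 * Module.finrank k k⟮ε + algebraMap k K (-1) / ε⟯) := by
  obtain ⟨t, rfl⟩ := Nat.exists_eq_add_of_le' ht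
  refine (minFaithfulDim_sylow_PGL_two_pow hq4 hs (neg_one_ne_one_of_two_ne_zero h2) hε
    (t := t) P).trans ?_
  rw [show 2 * (t + 1) - 1 = 2 * t + 1 by omega]
  ring

end Assembly

theorem stmt4 (p r q s : ℕ) (hp : p.Prime) (hodd : p ≠ 2) (hr : 1 ≤ r)
    (hq : q = p ^ r) (hq4 : q % 4 = 3) (hs : s = padicValNat 2 (q + 1) + 1)
    (k : Type*) [Field k] (hchar : ringChar k ≠ 2)
    (ε ξ : AlgebraicClosure k) (hε : IsPrimitiveRoot ε (2 ^ s))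
    (hξ : IsPrimitiveRoot ξ (2 ^ (s - 1)))
    (F : Type*) [Field F] [Fintype F] (hF : Fintype.card F = q)
    (n : ℕ)
    (P : Sylow 2 (Matrix.GeneralLinearGroup (Fin n) F ⧸
      Subgroup.center (Matrix.GeneralLinearGroup (Fin n) F))) :
    (Odd n → ∀ P' : Sylow 2 (Matrix.GeneralLinearGroup (Fin (n - 1)) F),
      minFaithfulDim k ↥P = minFaithfulDim k ↥P') ∧
    (n = 2 →
      ((∃ σ : k⟮ξ⟯ ≃ₐ[k] k⟮ξ⟯, σ (AdjoinSimple.gen k ξ) = (AdjoinSimple.gen k ξ)⁻¹) →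
        minFaithfulDim k ↥P = Module.finrank k (IntermediateField.adjoin k {ξ})) ∧
      (¬ (∃ σ : k⟮ξ⟯ ≃ₐ[k] k⟮ξ⟯, σ (AdjoinSimple.gen k ξ) = (AdjoinSimple.gen k ξ)⁻¹) →
        minFaithfulDim k ↥P = 2 * Module.finrank k (IntermediateField.adjoin k {ξ}))) ∧
    (∀ m : ℕ, 2 ≤ m → (∀ t : ℕ, m ≠ 2 ^ t) → n = 2 * m →
      ((∃ σ : k⟮ε⟯ ≃ₐ[k] k⟮ε⟯,
          σ (AdjoinSimple.gen k ε) = (AdjoinSimple.gen k ε) ^ (2 ^ (s - 1) - 1)) →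
        minFaithfulDim k ↥P =
          2 ^ (1 + padicValNat 2 m) * (m - 2 ^ padicValNat 2 m) *
            Module.finrank k (IntermediateField.adjoin k {ε})) ∧
      (¬ (∃ σ : k⟮ε⟯ ≃ₐ[k] k⟮ε⟯,
          σ (AdjoinSimple.gen k ε) = (AdjoinSimple.gen k ε) ^ (2 ^ (s - 1) - 1)) →
        minFaithfulDim k ↥P =
          2 ^ (2 + padicValNat 2 m) * (m - 2 ^ padicValNat 2 m) *
            Module.finrank k (IntermediateField.adjoin k {ε}))) ∧
    (∀ t : ℕ, 1 ≤ t → n = 2 * 2 ^ t →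
      ((∃ σ : k⟮ε⟯ ≃ₐ[k] k⟮ε⟯,
          σ (AdjoinSimple.gen k ε) = (AdjoinSimple.gen k ε) ^ (2 ^ (s - 1) - 1)) →
        minFaithfulDim k ↥P =
          2 ^ (2 * t - 1) * Module.finrank k (IntermediateField.adjoin k {ε})) ∧
      (¬ (∃ σ : k⟮ε⟯ ≃ₐ[k] k⟮ε⟯,
          σ (AdjoinSimple.gen k ε) = (AdjoinSimple.gen k ε) ^ (2 ^ (s - 1) - 1)) →
        minFaithfulDim k ↥P =
          2 ^ (2 * t) * Module.finrank k (IntermediateField.adjoin k {ε}))) := by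
  subst hF
  have h2 : (2 : k) ≠ 0 := Ring.two_ne_zero hchar
  have hs3 := three_le_of_mod_four hq4 hs
  refine ⟨?_, ?_, ?_, ?_⟩
  · rintro ⟨j, rfl⟩ P'
    exact minFaithfulDim_sylow_PGL_odd hq4 (even_two_mul j) P P' k
  · rintro rfl
    have hd : minFaithfulDim k ↥P = _ := minFaithfulDim_sylow_PGL_two hq4 hs h2 hξ P
    refine ⟨fun h => hd.trans ?_, fun h => hd.trans ?_⟩
    · rw [mul_comm, two_mul_finrank_trace_eq_of_inv hs3 h2 hξ h]
    · rw [mul_comm, finrank_trace_eq_of_not_inv h2 hξ h]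
  · rintro m hm hpow rfl
    have hd : minFaithfulDim k ↥P = _ := minFaithfulDim_sylow_PGL_not_two_pow hq4 hs h2 hε hm hpow P
    refine ⟨fun h => hd.trans ?_, fun h => hd.trans ?_⟩
    · rw [two_mul_finrank_twisted_trace_eq hs3 h2 hε h]
    · rw [finrank_twisted_trace_eq hs3 h2 hε h]
      ring
  · rintro t ht rfl
    have hd : minFaithfulDim k ↥P = _ := minFaithfulDim_sylow_PGL_two_mul_two_pow hq4 hs h2 hε ht P
    refine ⟨fun h => hd.trans ?_, fun h => hd.trans ?_⟩
    · rw [two_mul_finrank_twisted_trace_eq hs3 h2 hε h]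
    · rw [finrank_twisted_trace_eq hs3 h2 hε h, ← mul_assoc, ← pow_succ,
        Nat.sub_add_cancel (by omega)]
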